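/- arXiv:2004.01365 — 3 statements merged into one kernel-verified Lean document; each statement's English description precedes it below -/
import Mathlib

section
/- If G is a connected (P_5, 4-wheel)-free atom that contains an induced 5-wheel, then G is a nice graph. -/
open SimpleGraph

/-- `G` contains no induced copy of `H`. -/
def InducedFree {W V : Type*} (H : SimpleGraph W) (G : SimpleGraph V) : Prop :=
  IsEmpty (H ↪g G)

/-- The `k`-wheel: a chordless cycle `C_k` plus an extra vertex adjacent to all of it. -/
def wheel (k : ℕ) : SimpleGraph (Fin k ⊕ Unit) :=
  SimpleGraph.fromRel (fun x y =>
    (∃ a b, x = Sum.inl a ∧ y = Sum.inl b ∧ (SimpleGraph.cycleGraph k).Adj a b) ∨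
    (x.isLeft ∧ y.isRight))

/-- A stable (independent) set: pairwise nonadjacent vertices. -/
def IsStableSet {V : Type*} (G : SimpleGraph V) (S : Set V) : Prop :=
  S.Pairwise (fun a b => ¬ G.Adj a b)

/-- A graph is nice if it has three disjoint stable sets whose removal
drops the clique number by at least 2. -/
def IsNice {V : Type*} (G : SimpleGraph V) : Prop :=
  ∃ S₁ S₂ S₃ : Set V, IsStableSet G S₁ ∧ IsStableSet G S₂ ∧ IsStableSet G S₃ ∧
    Disjoint S₁ S₂ ∧ Disjoint S₁ S₃ ∧ Disjoint S₂ S₃ ∧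
    (G.induce ((S₁ ∪ S₂ ∪ S₃)ᶜ)).cliqueNum ≤ G.cliqueNum - 2

/-- A quasi-line graph: every neighborhood is the union of two cliques. -/
def IsQuasiLine {V : Type*} (G : SimpleGraph V) : Prop :=
  ∀ v : V, ∃ K₁ K₂ : Set V, G.IsClique K₁ ∧ G.IsClique K₂ ∧
    G.neighborSet v = K₁ ∪ K₂

/-- A clique cutset: a clique whose removal increases the number of
connected components. -/
def HasCliqueCutset {V : Type*} (G : SimpleGraph V) : Prop :=
  ∃ Q : Set V, G.IsClique Q ∧
    Nat.card G.ConnectedComponent < Nat.card (G.induce (Qᶜ)).ConnectedComponent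

/-- An atom is a graph with no clique cutset. -/
def IsGraphAtom {V : Type*} (G : SimpleGraph V) : Prop := ¬ HasCliqueCutset G

/-- A perfect graph: every induced subgraph has chromatic number equal to
its clique number. -/
def IsPerfect {V : Type*} (G : SimpleGraph V) : Prop :=
  ∀ S : Set V, (G.induce S).chromaticNumber = ((G.induce S).cliqueNum : ℕ∞)

/-- Elementwise form of being `(P₅, 4-wheel)`-free. -/
structure P5W4Free {V : Type*} (G : SimpleGraph V) : Prop where
  p5 : ∀ a b c d e, G.Adj a b → G.Adj b c → G.Adj c d → G.Adj d e → ¬ G.Adj a c → ¬ G.Adj a d →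
    ¬ G.Adj a e → ¬ G.Adj b d → ¬ G.Adj b e → ¬ G.Adj c e → False
  w4 : ∀ m a b c d, G.Adj m a → G.Adj m b → G.Adj m c → G.Adj m d → G.Adj a b → G.Adj b c →
    G.Adj c d → G.Adj d a → ¬ G.Adj a c → ¬ G.Adj b d → a = c ∨ b = d

/-- The vertices `v₀, …, v₄` form, in this order, a chordless cycle in the neighbourhood of `z`. -/
structure IsWheel {V : Type*} (G : SimpleGraph V) (z v₀ v₁ v₂ v₃ v₄ : V) : Prop where
  a01 : G.Adj v₀ v₁
  a12 : G.Adj v₁ v₂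
  a23 : G.Adj v₂ v₃
  a34 : G.Adj v₃ v₄
  a40 : G.Adj v₄ v₀
  n02 : ¬ G.Adj v₀ v₂
  n13 : ¬ G.Adj v₁ v₃
  n24 : ¬ G.Adj v₂ v₄
  n30 : ¬ G.Adj v₃ v₀
  n41 : ¬ G.Adj v₄ v₁
  z0 : G.Adj z v₀
  z1 : G.Adj z v₁
  z2 : G.Adj z v₂
  z3 : G.Adj z v₃
  z4 : G.Adj z v₄

/-- Neighbours of the hub that are clones of the rim vertex `v₀`. -/
def IsX {V : Type*} (G : SimpleGraph V) (z v₀ v₁ v₂ v₃ v₄ u : V) : Prop :=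
  (u = v₀ ∨ G.Adj u v₀) ∧ G.Adj u z ∧ G.Adj u v₁ ∧ G.Adj u v₄ ∧ ¬ G.Adj u v₂ ∧ ¬ G.Adj u v₃

/-- Non-neighbours of the hub whose rim neighbours are those of `v₀`. -/
def IsA {V : Type*} (G : SimpleGraph V) (z v₀ v₁ v₂ v₃ v₄ u : V) : Prop :=
  ¬ G.Adj u v₀ ∧ ¬ G.Adj u z ∧ G.Adj u v₁ ∧ G.Adj u v₄ ∧ ¬ G.Adj u v₂ ∧ ¬ G.Adj u v₃

/-- Non-neighbours of the hub whose rim non-neighbours are the neighbours of `v₀`. -/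
def IsB {V : Type*} (G : SimpleGraph V) (z v₀ v₁ v₂ v₃ v₄ u : V) : Prop :=
  G.Adj u v₀ ∧ ¬ G.Adj u z ∧ ¬ G.Adj u v₁ ∧ ¬ G.Adj u v₄ ∧ G.Adj u v₂ ∧ G.Adj u v₃

/-- Vertices complete to the rim. -/
def IsZ {V : Type*} (G : SimpleGraph V) (v₀ v₁ v₂ v₃ v₄ u : V) : Prop :=
  G.Adj u v₀ ∧ G.Adj u v₁ ∧ G.Adj u v₂ ∧ G.Adj u v₃ ∧ G.Adj u v₄

/-- Vertices anticomplete to the rim. -/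
def IsT {V : Type*} (G : SimpleGraph V) (v₀ v₁ v₂ v₃ v₄ u : V) : Prop :=
  ¬ G.Adj u v₀ ∧ ¬ G.Adj u v₁ ∧ ¬ G.Adj u v₂ ∧ ¬ G.Adj u v₃ ∧ ¬ G.Adj u v₄

namespace IsWheel

variable {V : Type*} {G : SimpleGraph V} {z v₀ v₁ v₂ v₃ v₄ : V}

theorem hub_hub (F : P5W4Free G) (h : IsWheel G z v₀ v₁ v₂ v₃ v₄) {u w : V}
    (hu : IsZ G v₀ v₁ v₂ v₃ v₄ u) (hw : IsZ G v₀ v₁ v₂ v₃ v₄ w) :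
    u = w ∨ G.Adj u w := by
  grind [F.w4 v₁ u v₀ w v₂, G.adj_comm, G.loopless, IsZ, IsWheel]

theorem hub_x (F : P5W4Free G) (h : IsWheel G z v₀ v₁ v₂ v₃ v₄) {u x : V}
    (hu : IsZ G v₀ v₁ v₂ v₃ v₄ u) (hx : IsX G z v₀ v₁ v₂ v₃ v₄ x) :
    G.Adj u x := by
  grind [F.w4 v₀ u v₁ x v₄, G.adj_comm, G.loopless, IsX, IsZ, IsWheel]

theorem hub_a (F : P5W4Free G) (h : IsWheel G z v₀ v₁ v₂ v₃ v₄) {u a : V}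
    (hu : IsZ G v₀ v₁ v₂ v₃ v₄ u) (ha : IsA G z v₀ v₁ v₂ v₃ v₄ a) :
    ¬ G.Adj u a := by
  grind [F.w4 u a v₁ v₀ v₄, G.adj_comm, G.loopless, IsA, IsZ, IsWheel]

theorem hub_b (F : P5W4Free G) (h : IsWheel G z v₀ v₁ v₂ v₃ v₄) {u b : V}
    (hu : IsZ G v₀ v₁ v₂ v₃ v₄ u) (hb : IsB G z v₀ v₁ v₂ v₃ v₄ b) :
    ¬ G.Adj u b := by
  grind [F.w4 u b v₀ v₁ v₂, G.adj_comm, G.loopless, IsB, IsZ, IsWheel]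

theorem x_x_zero (F : P5W4Free G) (h : IsWheel G z v₀ v₁ v₂ v₃ v₄) {x y : V}
    (hx : IsX G z v₀ v₁ v₂ v₃ v₄ x) (hy : IsX G z v₀ v₁ v₂ v₃ v₄ y) :
    x = y ∨ G.Adj x y := by
  grind [F.w4 v₀ v₁ x v₄ y, G.adj_comm, G.loopless, IsX, IsWheel]

theorem x_x_one (F : P5W4Free G) (h : IsWheel G z v₀ v₁ v₂ v₃ v₄) {x y : V}
    (hx : IsX G z v₀ v₁ v₂ v₃ v₄ x) (hy : IsX G z v₁ v₂ v₃ v₄ v₀ y) :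
    G.Adj x y := by
  grind [F.p5 v₃ v₂ y v₀ x, G.adj_comm, G.loopless, IsX, IsWheel]

theorem x_x_two (F : P5W4Free G) (h : IsWheel G z v₀ v₁ v₂ v₃ v₄) {x y : V}
    (hx : IsX G z v₀ v₁ v₂ v₃ v₄ x) (hy : IsX G z v₂ v₃ v₄ v₀ v₁ y) :
    ¬ G.Adj x y := by
  grind [F.w4 z v₃ v₄ x y, G.adj_comm, G.loopless, IsX, IsWheel]

theorem x_t (F : P5W4Free G) (h : IsWheel G z v₀ v₁ v₂ v₃ v₄) {x t : V}
    (hx : IsX G z v₀ v₁ v₂ v₃ v₄ x) (ht : IsT G v₀ v₁ v₂ v₃ v₄ t) :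
    ¬ G.Adj x t := by
  grind [F.p5 t x v₁ v₂ v₃, G.adj_comm, G.loopless, IsT, IsX, IsWheel]

theorem a_x_zero (F : P5W4Free G) (h : IsWheel G z v₀ v₁ v₂ v₃ v₄) {a x : V}
    (ha : IsA G z v₀ v₁ v₂ v₃ v₄ a) (hx : IsX G z v₀ v₁ v₂ v₃ v₄ x) :
    ¬ G.Adj a x := by
  grind [F.w4 x a v₁ v₀ v₄, G.adj_comm, G.loopless, IsA, IsX, IsWheel]

theorem a_x_one (F : P5W4Free G) (h : IsWheel G z v₀ v₁ v₂ v₃ v₄) {a x : V}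
    (ha : IsA G z v₀ v₁ v₂ v₃ v₄ a) (hx : IsX G z v₁ v₂ v₃ v₄ v₀ x) :
    G.Adj a x := by
  grind [F.p5 a v₄ v₀ x v₂, G.adj_comm, G.loopless, IsA, IsX, IsWheel]

theorem a_x_two (F : P5W4Free G) (h : IsWheel G z v₀ v₁ v₂ v₃ v₄) {a x : V}
    (ha : IsA G z v₀ v₁ v₂ v₃ v₄ a) (hx : IsX G z v₂ v₃ v₄ v₀ v₁ x) :
    ¬ G.Adj a x := by
  grind [F.p5 v₀ v₄ a x v₂, G.adj_comm, G.loopless, IsA, IsX, IsWheel]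

theorem a_x_three (F : P5W4Free G) (h : IsWheel G z v₀ v₁ v₂ v₃ v₄) {a x : V}
    (ha : IsA G z v₀ v₁ v₂ v₃ v₄ a) (hx : IsX G z v₃ v₄ v₀ v₁ v₂ x) :
    ¬ G.Adj a x := by
  grind [F.p5 v₀ v₁ a x v₃, G.adj_comm, G.loopless, IsA, IsX, IsWheel]

theorem a_x_four (F : P5W4Free G) (h : IsWheel G z v₀ v₁ v₂ v₃ v₄) {a x : V}
    (ha : IsA G z v₀ v₁ v₂ v₃ v₄ a) (hx : IsX G z v₄ v₀ v₁ v₂ v₃ x) :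
    G.Adj a x := by
  grind [F.p5 a v₁ v₀ x v₃, G.adj_comm, G.loopless, IsA, IsX, IsWheel]

theorem b_x_zero (F : P5W4Free G) (h : IsWheel G z v₀ v₁ v₂ v₃ v₄) {b x : V}
    (hb : IsB G z v₀ v₁ v₂ v₃ v₄ b) (hx : IsX G z v₀ v₁ v₂ v₃ v₄ x) :
    G.Adj b x := by
  grind [F.p5 b v₂ v₁ x v₄, G.adj_comm, G.loopless, IsB, IsX, IsWheel]

theorem b_x_one (F : P5W4Free G) (h : IsWheel G z v₀ v₁ v₂ v₃ v₄) {b x : V}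
    (hb : IsB G z v₀ v₁ v₂ v₃ v₄ b) (hx : IsX G z v₁ v₂ v₃ v₄ v₀ x) :
    ¬ G.Adj b x := by
  grind [F.w4 x b v₀ v₁ v₂, G.adj_comm, G.loopless, IsB, IsX, IsWheel]

theorem b_x_two (F : P5W4Free G) (h : IsWheel G z v₀ v₁ v₂ v₃ v₄) {b x : V}
    (hb : IsB G z v₀ v₁ v₂ v₃ v₄ b) (hx : IsX G z v₂ v₃ v₄ v₀ v₁ x) :
    G.Adj b x := by
  grind [F.p5 v₄ v₀ b v₂ x, G.adj_comm, G.loopless, IsB, IsX, IsWheel]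

theorem b_x_three (F : P5W4Free G) (h : IsWheel G z v₀ v₁ v₂ v₃ v₄) {b x : V}
    (hb : IsB G z v₀ v₁ v₂ v₃ v₄ b) (hx : IsX G z v₃ v₄ v₀ v₁ v₂ x) :
    G.Adj b x := by
  grind [F.p5 v₁ v₀ b v₃ x, G.adj_comm, G.loopless, IsB, IsX, IsWheel]

theorem b_x_four (F : P5W4Free G) (h : IsWheel G z v₀ v₁ v₂ v₃ v₄) {b x : V}
    (hb : IsB G z v₀ v₁ v₂ v₃ v₄ b) (hx : IsX G z v₄ v₀ v₁ v₂ v₃ x) :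
    ¬ G.Adj b x := by
  grind [F.w4 x b v₀ v₄ v₃, G.adj_comm, G.loopless, IsB, IsX, IsWheel]

theorem a_a_one (F : P5W4Free G) (h : IsWheel G z v₀ v₁ v₂ v₃ v₄) {a c : V}
    (ha : IsA G z v₀ v₁ v₂ v₃ v₄ a) (hc : IsA G z v₁ v₂ v₃ v₄ v₀ c) :
    False := by
  grind [F.p5 a c v₀ z v₃, F.p5 a v₄ v₀ c v₂, G.adj_comm, G.loopless, IsA, IsWheel]

theorem a_a_two (F : P5W4Free G) (h : IsWheel G z v₀ v₁ v₂ v₃ v₄) {a c : V}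
    (ha : IsA G z v₀ v₁ v₂ v₃ v₄ a) (hc : IsA G z v₂ v₃ v₄ v₀ v₁ c) :
    ¬ G.Adj a c := by
  grind [F.p5 a c v₃ z v₀, G.adj_comm, G.loopless, IsA, IsWheel]

theorem a_trans (F : P5W4Free G) (h : IsWheel G z v₀ v₁ v₂ v₃ v₄) {a c d : V}
    (ha : IsA G z v₀ v₁ v₂ v₃ v₄ a) (hc : IsA G z v₀ v₁ v₂ v₃ v₄ c) (hd : IsA G z v₀ v₁ v₂ v₃ v₄ d)
    (hac : G.Adj a c) (hcd : G.Adj c d) (had : a ≠ d) :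
    G.Adj a d := by
  grind [F.w4 c a v₁ d v₄, G.adj_comm, G.loopless, IsA, IsWheel]

theorem a_b_zero (F : P5W4Free G) (h : IsWheel G z v₀ v₁ v₂ v₃ v₄) {a b : V}
    (ha : IsA G z v₀ v₁ v₂ v₃ v₄ a) (hb : IsB G z v₀ v₁ v₂ v₃ v₄ b) :
    G.Adj a b := by
  grind [F.p5 a v₁ v₀ b v₃, G.adj_comm, G.loopless, IsA, IsB, IsWheel]

theorem a_b_one (F : P5W4Free G) (h : IsWheel G z v₀ v₁ v₂ v₃ v₄) {a b : V}
    (ha : IsA G z v₀ v₁ v₂ v₃ v₄ a) (hb : IsB G z v₁ v₂ v₃ v₄ v₀ b) :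
    ¬ G.Adj a b := by
  grind [F.p5 a b v₃ z v₀, G.adj_comm, G.loopless, IsA, IsB, IsWheel]

theorem a_b_two (F : P5W4Free G) (h : IsWheel G z v₀ v₁ v₂ v₃ v₄) {a b : V}
    (ha : IsA G z v₀ v₁ v₂ v₃ v₄ a) (hb : IsB G z v₂ v₃ v₄ v₀ v₁ b) :
    ¬ G.Adj a b := by
  grind [F.p5 a b v₀ z v₃, G.adj_comm, G.loopless, IsA, IsB, IsWheel]

theorem a_b_three (F : P5W4Free G) (h : IsWheel G z v₀ v₁ v₂ v₃ v₄) {a b : V}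
    (ha : IsA G z v₀ v₁ v₂ v₃ v₄ a) (hb : IsB G z v₃ v₄ v₀ v₁ v₂ b) :
    ¬ G.Adj a b := by
  grind [F.p5 a b v₀ z v₂, G.adj_comm, G.loopless, IsA, IsB, IsWheel]

theorem a_b_four (F : P5W4Free G) (h : IsWheel G z v₀ v₁ v₂ v₃ v₄) {a b : V}
    (ha : IsA G z v₀ v₁ v₂ v₃ v₄ a) (hb : IsB G z v₄ v₀ v₁ v₂ v₃ b) :
    ¬ G.Adj a b := by
  grind [F.p5 a b v₂ z v₀, G.adj_comm, G.loopless, IsA, IsB, IsWheel]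

theorem b_b_one (F : P5W4Free G) (h : IsWheel G z v₀ v₁ v₂ v₃ v₄) {b c : V}
    (hb : IsB G z v₀ v₁ v₂ v₃ v₄ b) (hc : IsB G z v₁ v₂ v₃ v₄ v₀ c) :
    G.Adj b c := by
  grind [F.p5 c v₄ v₀ b v₂, G.adj_comm, G.loopless, IsB, IsWheel]

theorem b_b_two (F : P5W4Free G) (h : IsWheel G z v₀ v₁ v₂ v₃ v₄) {b c : V}
    (hb : IsB G z v₀ v₁ v₂ v₃ v₄ b) (hc : IsB G z v₂ v₃ v₄ v₀ v₁ c) :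
    ¬ G.Adj b c := by
  grind [F.p5 c b v₃ z v₁, G.adj_comm, G.loopless, IsB, IsWheel]

theorem b_trans (F : P5W4Free G) (h : IsWheel G z v₀ v₁ v₂ v₃ v₄) {b c d : V}
    (hb : IsB G z v₀ v₁ v₂ v₃ v₄ b) (hc : IsB G z v₀ v₁ v₂ v₃ v₄ c) (hd : IsB G z v₀ v₁ v₂ v₃ v₄ d)
    (hbc : G.Adj b c) (hcd : G.Adj c d) (hbd : b ≠ d) :
    G.Adj b d := by
  grind [F.w4 c b v₀ d v₂, G.adj_comm, G.loopless, IsB, IsWheel]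

theorem a_t (F : P5W4Free G) (h : IsWheel G z v₀ v₁ v₂ v₃ v₄) {a t : V}
    (ha : IsA G z v₀ v₁ v₂ v₃ v₄ a) (ht : IsT G v₀ v₁ v₂ v₃ v₄ t) :
    ¬ G.Adj a t := by
  grind [F.p5 t a v₁ v₂ v₃, G.adj_comm, G.loopless, IsA, IsT, IsWheel]

theorem t_b_of_b_adj (F : P5W4Free G) (h : IsWheel G z v₀ v₁ v₂ v₃ v₄) {b c t : V}
    (hb : IsB G z v₀ v₁ v₂ v₃ v₄ b) (hc : IsB G z v₀ v₁ v₂ v₃ v₄ c) (ht : IsT G v₀ v₁ v₂ v₃ v₄ t)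
    (hbc : G.Adj b c) (htb : G.Adj t b) :
    G.Adj t c := by
  grind [F.p5 c b t z v₁, F.p5 t b v₃ z v₁, G.adj_comm, G.loopless, IsB, IsT, IsWheel]

theorem t_b_of_t_adj (F : P5W4Free G) (h : IsWheel G z v₀ v₁ v₂ v₃ v₄) {b s t : V}
    (hb : IsB G z v₀ v₁ v₂ v₃ v₄ b) (hs : IsT G v₀ v₁ v₂ v₃ v₄ s) (ht : IsT G v₀ v₁ v₂ v₃ v₄ t)
    (hst : G.Adj s t) (hsb : G.Adj s b) :
    G.Adj t b := by
  grind [F.p5 t s b v₀ v₁, G.adj_comm, G.loopless, IsB, IsT, IsWheel]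

theorem t_hub (F : P5W4Free G) (h : IsWheel G z v₀ v₁ v₂ v₃ v₄) {b t u : V}
    (hb : IsB G z v₀ v₁ v₂ v₃ v₄ b) (ht : IsT G v₀ v₁ v₂ v₃ v₄ t) (hu : IsZ G v₀ v₁ v₂ v₃ v₄ u)
    (htb : G.Adj t b) :
    G.Adj t u := by
  grind [F.p5 t b v₃ u v₁, hub_b F h hu hb, G.adj_comm, G.loopless, IsB, IsT, IsZ, IsWheel]

theorem center_isZ (h : IsWheel G z v₀ v₁ v₂ v₃ v₄) : IsZ G v₀ v₁ v₂ v₃ v₄ z :=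
  ⟨h.z0, h.z1, h.z2, h.z3, h.z4⟩

theorem t_trans (F : P5W4Free G) (h : IsWheel G z v₀ v₁ v₂ v₃ v₄) {b s t r : V}
    (hb : IsB G z v₀ v₁ v₂ v₃ v₄ b) (hs : IsT G v₀ v₁ v₂ v₃ v₄ s) (ht : IsT G v₀ v₁ v₂ v₃ v₄ t)
    (hr : IsT G v₀ v₁ v₂ v₃ v₄ r)
    (hsb : G.Adj s b) (hst : G.Adj s t) (htr : G.Adj t r) (hsr : s ≠ r) :
    G.Adj s r := by
  grind [F.w4 t b r z s, t_b_of_t_adj F h hb hs ht hst hsb, t_b_of_t_adj F h hb ht hr htr,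
    t_hub F h hb hs (center_isZ h) hsb, t_hub F h hb ht (center_isZ h),
    t_hub F h hb hr (center_isZ h), G.adj_comm, G.loopless, IsB, IsT, IsWheel]

theorem t_b_of_a (F : P5W4Free G) (h : IsWheel G z v₀ v₁ v₂ v₃ v₄) {a b t : V}
    (ha : IsA G z v₀ v₁ v₂ v₃ v₄ a) (hb : IsB G z v₀ v₁ v₂ v₃ v₄ b) (ht : IsT G v₀ v₁ v₂ v₃ v₄ t)
    (htz : G.Adj t z) :
    G.Adj t b := by
  grind [F.p5 a b v₀ z t, a_b_zero F h ha hb, a_t F h ha ht, G.adj_comm, G.loopless, IsA, IsB,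
    IsT, IsWheel]

theorem t_b_of_a_two (F : P5W4Free G) (h : IsWheel G z v₀ v₁ v₂ v₃ v₄) {a b t : V}
    (ha : IsA G z v₀ v₁ v₂ v₃ v₄ a) (hb : IsB G z v₂ v₃ v₄ v₀ v₁ b) (ht : IsT G v₀ v₁ v₂ v₃ v₄ t) :
    ¬ G.Adj t b := by
  grind [F.p5 a v₁ v₀ b t, a_b_two F h ha hb, a_t F h ha ht, G.adj_comm, G.loopless, IsA, IsB,
    IsT, IsWheel]

theorem t_b_of_a_three (F : P5W4Free G) (h : IsWheel G z v₀ v₁ v₂ v₃ v₄) {a b t : V}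
    (ha : IsA G z v₀ v₁ v₂ v₃ v₄ a) (hb : IsB G z v₃ v₄ v₀ v₁ v₂ b) (ht : IsT G v₀ v₁ v₂ v₃ v₄ t) :
    ¬ G.Adj t b := by
  grind [F.p5 a v₄ v₀ b t, a_b_three F h ha hb, a_t F h ha ht, G.adj_comm, G.loopless, IsA, IsB,
    IsT, IsWheel]

theorem t_b_or_b_one (F : P5W4Free G) (h : IsWheel G z v₀ v₁ v₂ v₃ v₄) {b c t : V}
    (hb : IsB G z v₀ v₁ v₂ v₃ v₄ b) (hc : IsB G z v₁ v₂ v₃ v₄ v₀ c) (ht : IsT G v₀ v₁ v₂ v₃ v₄ t)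
    (htz : G.Adj t z) :
    G.Adj t b ∨ G.Adj t c := by
  grind [F.p5 c b v₀ z t, b_b_one F h hb hc, G.adj_comm, G.loopless, IsB, IsT, IsWheel]

theorem t_b_iff_b_two (F : P5W4Free G) (h : IsWheel G z v₀ v₁ v₂ v₃ v₄) {b c t : V}
    (hb : IsB G z v₀ v₁ v₂ v₃ v₄ b) (hc : IsB G z v₂ v₃ v₄ v₀ v₁ c) (ht : IsT G v₀ v₁ v₂ v₃ v₄ t) :
    G.Adj t b ↔ G.Adj t c := by
  grind [F.p5 t b v₂ c v₄, F.p5 t c v₀ b v₃, b_b_two F h hb hc, G.adj_comm, G.loopless, IsB, IsT,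
    IsWheel]

theorem rotate (h : IsWheel G z v₀ v₁ v₂ v₃ v₄) : IsWheel G z v₁ v₂ v₃ v₄ v₀ :=
  ⟨h.a12, h.a23, h.a34, h.a40, h.a01, h.n13, h.n24, fun e => h.n30 e, h.n41,
    fun e => h.n02 e, h.z1, h.z2, h.z3, h.z4, h.z0⟩

theorem isT_or_isX_or_isA (F : P5W4Free G) (h : IsWheel G z v₀ v₁ v₂ v₃ v₄) {u : V}
    (h2 : ¬ G.Adj u v₂) (h3 : ¬ G.Adj u v₃) :
    IsT G v₀ v₁ v₂ v₃ v₄ u ∨ IsX G z v₀ v₁ v₂ v₃ v₄ u ∨ IsA G z v₀ v₁ v₂ v₃ v₄ u := by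
  grind [F.p5 u v₀ v₁ v₂ v₃, F.p5 u v₁ v₂ v₃ v₄, F.p5 u v₄ v₃ v₂ v₁, F.w4 v₀ v₄ u v₁ z,
    F.w4 z u v₁ v₀ v₄, G.adj_comm, G.loopless, IsX, IsA, IsT, IsWheel]

theorem isB_of_adj (F : P5W4Free G) (h : IsWheel G z v₀ v₁ v₂ v₃ v₄) {u : V}
    (h1 : ¬ G.Adj u v₁) (h4 : ¬ G.Adj u v₄) (h0 : G.Adj u v₀) (h2 : G.Adj u v₂)
    (h3 : G.Adj u v₃) : IsB G z v₀ v₁ v₂ v₃ v₄ u := by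
  grind [F.w4 z u v₀ v₁ v₂, G.adj_comm, G.loopless, IsB, IsWheel]

theorem adj_of_adj (F : P5W4Free G) (h : IsWheel G z v₀ v₁ v₂ v₃ v₄) {u : V}
    (h1 : G.Adj u v₁) (h4 : G.Adj u v₄) (h2 : G.Adj u v₂) (h3 : G.Adj u v₃) : G.Adj u v₀ := by
  grind [F.w4 z u v₁ v₀ v₄, F.w4 v₂ v₁ u v₃ z, G.adj_comm, G.loopless, IsWheel]

theorem classify (F : P5W4Free G) (h : IsWheel G z v₀ v₁ v₂ v₃ v₄) (u : V) :
    IsZ G v₀ v₁ v₂ v₃ v₄ u ∨ IsT G v₀ v₁ v₂ v₃ v₄ u ∨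
    (IsX G z v₀ v₁ v₂ v₃ v₄ u ∨ IsA G z v₀ v₁ v₂ v₃ v₄ u ∨ IsB G z v₀ v₁ v₂ v₃ v₄ u) ∨
    (IsX G z v₁ v₂ v₃ v₄ v₀ u ∨ IsA G z v₁ v₂ v₃ v₄ v₀ u ∨ IsB G z v₁ v₂ v₃ v₄ v₀ u) ∨
    (IsX G z v₂ v₃ v₄ v₀ v₁ u ∨ IsA G z v₂ v₃ v₄ v₀ v₁ u ∨ IsB G z v₂ v₃ v₄ v₀ v₁ u) ∨
    (IsX G z v₃ v₄ v₀ v₁ v₂ u ∨ IsA G z v₃ v₄ v₀ v₁ v₂ u ∨ IsB G z v₃ v₄ v₀ v₁ v₂ u) ∨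
    (IsX G z v₄ v₀ v₁ v₂ v₃ u ∨ IsA G z v₄ v₀ v₁ v₂ v₃ u ∨ IsB G z v₄ v₀ v₁ v₂ v₃ u) := by
  have h1 := h.rotate
  have h2 := h1.rotate
  have h3 := h2.rotate
  have h4 := h3.rotate
  have a0 := h.isT_or_isX_or_isA F (u := u)
  have a1 := h1.isT_or_isX_or_isA F (u := u)
  have a2 := h2.isT_or_isX_or_isA F (u := u)
  have a3 := h3.isT_or_isX_or_isA F (u := u)
  have a4 := h4.isT_or_isX_or_isA F (u := u)
  have b0 := h.isB_of_adj F (u := u)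
  have b1 := h1.isB_of_adj F (u := u)
  have b2 := h2.isB_of_adj F (u := u)
  have b3 := h3.isB_of_adj F (u := u)
  have b4 := h4.isB_of_adj F (u := u)
  have c0 := h.adj_of_adj F (u := u)
  have c1 := h1.adj_of_adj F (u := u)
  have c2 := h2.adj_of_adj F (u := u)
  have c3 := h3.adj_of_adj F (u := u)
  have c4 := h4.adj_of_adj F (u := u)
  unfold IsZ
  unfold IsT at *
  clear h h1 h2 h3 h4 F
  by_cases e0 : G.Adj u v₀ <;> by_cases e1 : G.Adj u v₁ <;> by_cases e2 : G.Adj u v₂ <;>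
    by_cases e3 : G.Adj u v₃ <;> by_cases e4 : G.Adj u v₄ <;>
    simp only [e0, e1, e2, e3, e4, not_true_eq_false, not_false_eq_true, and_true, and_false,
      false_or, forall_const, IsEmpty.forall_iff, true_or] at * <;> tauto

end IsWheel

/-- Names of the classes of vertices of `G` relative to a fixed 5-wheel. -/
inductive PartIdx
  | x (i : Fin 5)
  | a (i : Fin 5)
  | b (i : Fin 5)
  | z
  | t

namespace PartIdx

/-- Pairs of classes that are complete to each other. -/
def Full : PartIdx → PartIdx → Prop
  | x i, x j => j = i + 1 ∨ i = j + 1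
  | x _, z => True
  | z, x _ => True
  | a i, x j => j = i + 1 ∨ j = i + 4
  | x j, a i => j = i + 1 ∨ j = i + 4
  | a i, b j => i = j
  | b j, a i => i = j
  | b i, x j => j = i ∨ j = i + 2 ∨ j = i + 3
  | x j, b i => j = i ∨ j = i + 2 ∨ j = i + 3
  | b i, b j => j = i + 1 ∨ i = j + 1
  | z, t => True
  | t, z => True
  | _, _ => False

/-- Pairs of distinct classes that may have edges between them. -/
def Linked : PartIdx → PartIdx → Prop
  | t, b _ => True
  | b _, t => True
  | p, q => Full p q

theorem Full.symm {p q : PartIdx} (h : Full p q) : Full q p := by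
  cases p <;> cases q <;> simp_all [Full, or_comm]

end PartIdx

open PartIdx

/-- The vertex classes `P` have the adjacencies forced by a 5-wheel in an atom. -/
structure IsDecomp {V : Type*} (G : SimpleGraph V) (P : PartIdx → Set V) : Prop where
  cover : ∀ u, ∃ p, u ∈ P p
  anti : ∀ p q u w, p ≠ q → ¬ Linked p q → u ∈ P p → w ∈ P q → ¬ G.Adj u w
  full : ∀ p q u w, Full p q → u ∈ P p → w ∈ P q → G.Adj u w
  disj : ∀ p q u, p ≠ q → u ∈ P p → u ∉ P q
  x_clique : ∀ i, G.IsClique (P (x i))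
  z_clique : G.IsClique (P z)
  x_nonempty : ∀ i, (P (x i)).Nonempty
  z_nonempty : (P z).Nonempty
  homog : ∀ p s u w, s ∈ P p → u ∈ P p → G.Adj s u → G.Adj w u → w ≠ s → G.Adj w s

/-- A subset of `s` that is stable and dominates `s`. -/
theorem exists_dominating_stable {V : Type*} [Finite V] (G : SimpleGraph V) (s : Set V) :
    ∃ I ⊆ s, IsStableSet G I ∧ ∀ u ∈ s, u ∉ I → ∃ w ∈ I, G.Adj w u := by
  obtain ⟨I, hI⟩ := (Set.toFinite {I : Set V | I ⊆ s ∧ IsStableSet G I}).exists_maximal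
    ⟨∅, by simp [IsStableSet]⟩
  refine ⟨I, hI.prop.1, hI.prop.2, fun u hu huI => ?_⟩
  by_contra! hno
  refine huI (hI.le_of_ge (y := insert u I) ⟨Set.insert_subset hu hI.prop.1, ?_⟩
    (Set.subset_insert u I) (Set.mem_insert u I))
  refine hI.prop.2.insert fun w hw _ => ⟨fun h => hno w hw h.symm, hno w hw⟩

theorem SimpleGraph.IsClique.ncard_le_cliqueNum {V : Type*} [Finite V] {G : SimpleGraph V}
    {K : Set V} (hK : G.IsClique K) : K.ncard ≤ G.cliqueNum := by
  classical
  have := Fintype.ofFinite V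
  rw [Set.ncard_eq_toFinset_card']
  exact SimpleGraph.IsClique.card_le_cliqueNum (tc := by simpa using hK)

theorem exists_maximal_isClique {V : Type*} [Finite V] {G : SimpleGraph V} {K : Set V}
    (hK : G.IsClique K) : ∃ L, K ⊆ L ∧ Maximal G.IsClique L :=
  (Set.toFinite {L | G.IsClique L}).exists_le_maximal hK

/-- Overlaps between three stable sets can be removed. -/
theorem isNice_of_stable {V : Type*} [Finite V] {G : SimpleGraph V} (S : Fin 3 → Set V)
    (hS : ∀ k, IsStableSet G (S k))
    (h : ∀ K, Maximal G.IsClique K → (K \ ⋃ k, S k).ncard + 2 ≤ G.cliqueNum) : IsNice G := by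
  refine ⟨S 0, S 1 \ S 0, S 2 \ (S 0 ∪ S 1), hS 0, (hS 1).mono Set.sdiff_subset,
    (hS 2).mono Set.sdiff_subset, disjoint_sdiff_self_right,
    Set.disjoint_sdiff_right.mono_left Set.subset_union_left,
    Set.disjoint_sdiff_right.mono_left (Set.sdiff_subset.trans Set.subset_union_right), ?_⟩
  have hU : S 0 ∪ S 1 \ S 0 ∪ S 2 \ (S 0 ∪ S 1) = ⋃ k, S k := by
    ext u
    simp only [Set.mem_union, Set.mem_sdiff, Set.mem_iUnion, Fin.exists_fin_succ]
    simp
    tauto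
  rw [hU]
  obtain ⟨K, hK⟩ := (G.induce (⋃ k, S k)ᶜ).exists_isNClique_cliqueNum
  have hK' : G.IsClique (Subtype.val '' (K : Set ↥(⋃ k, S k)ᶜ)) := by
    rintro _ ⟨u, hu, rfl⟩ _ ⟨w, hw, rfl⟩ huw
    exact hK.isClique hu hw (fun e => huw (congrArg _ e))
  obtain ⟨L, hKL, hL⟩ := exists_maximal_isClique hK'
  have h1 := h L hL
  have h2 : (Subtype.val '' (K : Set ↥(⋃ k, S k)ᶜ)).ncard ≤ (L \ ⋃ k, S k).ncard := by
    refine Set.ncard_le_ncard ?_ (Set.toFinite _)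
    rintro _ ⟨u, hu, rfl⟩
    exact ⟨hKL ⟨u, hu, rfl⟩, u.2⟩
  rw [Set.ncard_image_of_injective _ Subtype.val_injective, Set.ncard_coe_finset, hK.card_eq] at h2
  omega

namespace IsDecomp

variable {V : Type*} {G : SimpleGraph V} {P : PartIdx → Set V}

theorem linked_of_clique (D : IsDecomp G P) {K : Set V} (hK : G.IsClique K) {p q : PartIdx}
    (hpq : p ≠ q) (hp : (K ∩ P p).Nonempty) (hq : (K ∩ P q).Nonempty) : Linked p q := by
  obtain ⟨u, huK, hu⟩ := hp
  obtain ⟨w, hwK, hw⟩ := hq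
  by_contra hl
  exact D.anti p q u w hpq hl hu hw
    (hK huK hwK fun e => D.disj p q u hpq hu (e ▸ hw))

/-- A colouring of the classes with three colours (and `0` for uncoloured) such that every maximal
clique meets two coloured classes, or is not maximum and meets one, yields niceness. -/
theorem isNice_of_colouring [Finite V] (D : IsDecomp G P) (c : PartIdx → Fin 4)
    (hc : ∀ p q, (P p).Nonempty → (P q).Nonempty → Linked p q → c p = c q → c p = 0)
    (h : ∀ K, Maximal G.IsClique K →
      (∃ p q, p ≠ q ∧ (K ∩ P p).Nonempty ∧ (K ∩ P q).Nonempty ∧ c p ≠ 0 ∧ c q ≠ 0) ∨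
      ∃ p, (K ∩ P p).Nonempty ∧ c p ≠ 0 ∧ K.ncard < G.cliqueNum) : IsNice G := by
  choose I hIP hI hdom using fun p => exists_dominating_stable G (P p)
  have hrep : ∀ K, Maximal G.IsClique K → ∀ p, (K ∩ P p).Nonempty → (K ∩ I p).Nonempty := by
    rintro K hK p ⟨u, huK, hu⟩
    by_cases huI : u ∈ I p
    · exact ⟨u, huK, huI⟩
    obtain ⟨s, hs, hsu⟩ := hdom p u hu huI
    refine ⟨s, ?_, hs⟩
    have : G.IsClique (insert s K) := by
      refine hK.prop.insert fun w hw hsw => ?_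
      by_cases hwu : w = u
      · exact hwu ▸ hsu
      · exact (D.homog p s u w (hIP p hs) hu hsu (hK.prop hw huK hwu) hsw.symm).symm
    exact hK.le_of_ge this (Set.subset_insert s K) (Set.mem_insert s K)
  have hmem : ∀ p, c p ≠ 0 → I p ⊆ ⋃ k : Fin 3, ⋃ q, ⋃ _ : c q = k.succ, I q := by
    intro p hp s hs
    obtain ⟨k, hk⟩ := Fin.exists_succ_eq.mpr hp
    simp only [Set.mem_iUnion]
    exact ⟨k, p, hk.symm, hs⟩
  refine isNice_of_stable (fun k => ⋃ q, ⋃ _ : c q = k.succ, I q) ?_ ?_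
  · intro k u hu w hw huw hadj
    simp only [Set.mem_iUnion] at hu hw
    obtain ⟨p, hp, hu⟩ := hu
    obtain ⟨q, hq, hw⟩ := hw
    by_cases hpq : p = q
    · subst hpq
      exact hI p hu hw huw hadj
    · by_cases hl : Linked p q
      · have := hc p q ⟨u, hIP p hu⟩ ⟨w, hIP q hw⟩ hl (hp.trans hq.symm)
        exact Fin.succ_ne_zero k (hp.symm.trans this)
      · exact D.anti p q u w hpq hl (hIP p hu) (hIP q hw) hadj
  · intro K hK
    have hle := hK.prop.ncard_le_cliqueNum
    rcases h K hK with ⟨p, q, hpq, hp, hq, hcp, hcq⟩ | ⟨p, hp, hcp, hlt⟩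
    · obtain ⟨s, hsK, hs⟩ := hrep K hK p hp
      obtain ⟨r, hrK, hr⟩ := hrep K hK q hq
      have hsr : s ≠ r := fun e => D.disj p q s hpq (hIP p hs) (e ▸ hIP q hr)
      have h1 : (K \ ⋃ k : Fin 3, ⋃ q, ⋃ _ : c q = k.succ, I q).ncard ≤ (K \ {s, r}).ncard := by
        refine Set.ncard_le_ncard (Set.sdiff_subset_sdiff_right ?_) (Set.toFinite _)
        rintro _ (rfl | rfl)
        exacts [hmem p hcp hs, hmem q hcq hr]
      have h2 := Set.ncard_sdiff_add_ncard_of_subset (s := {s, r}) (t := K)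
        (by rintro _ (rfl | rfl) <;> assumption) (Set.toFinite _)
      rw [Set.ncard_pair hsr] at h2
      omega
    · obtain ⟨s, hsK, hs⟩ := hrep K hK p hp
      have h1 : (K \ ⋃ k : Fin 3, ⋃ q, ⋃ _ : c q = k.succ, I q).ncard ≤ (K \ {s}).ncard := by
        refine Set.ncard_le_ncard (Set.sdiff_subset_sdiff_right ?_) (Set.toFinite _)
        rintro _ rfl
        exact hmem p hcp hs
      have h2 := Set.ncard_sdiff_add_ncard_of_subset (s := {s}) (t := K)
        (by rintro _ rfl; assumption) (Set.toFinite _)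
      rw [Set.ncard_singleton] at h2
      omega

end IsDecomp

/-- The possible sets `M` of classes met by a maximal clique. -/
theorem PartIdx.patterns (M : PartIdx → Prop) (hne : ∃ p, M p)
    (hl : ∀ p q, p ≠ q → M p → M q → Linked p q)
    (hx : ∀ i, (∀ p, M p → p = x i ∨ Full p (x i)) → M (x i))
    (hz : (∀ p, M p → p = z ∨ Full p z) → M z) :
    (∃ i, M z ∧ M (x i) ∧ M (x (i + 1))) ∨ (M z ∧ M t) ∨ (∃ i, M (a i) ∧ M (b i)) ∨
    (∃ i j, (j = i + 1 ∨ j = i + 4) ∧ M (a i) ∧ M (x j)) ∨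
    (∃ i, M (b i) ∧ M (x i) ∧ ∀ p, M p → p = b i ∨ p = x i) ∨
    (∃ i, M (b i) ∧ M (x (i + 2)) ∧ M (x (i + 3))) ∨
    (∃ i, M (b i) ∧ M (b (i + 1)) ∧ M (x (i + 3))) ∨
    (∃ i, M t ∧ M (b i) ∧ M (b (i + 1))) ∨
    (∃ i, M t ∧ M (b i) ∧ ∀ p, M p → p = t ∨ p = b i) := by
  by_contra! ⟨n1, n2, n3, n4, n5, n6, n7, n8, n9⟩
  have n1' : ∀ i, M z → M (x i) → ¬ M (x (i + 4)) := fun i h1 h2 h3 =>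
    n1 (i + 4) h1 h3 (by simpa [add_assoc] using h2)
  have n8' : ∀ i, M t → M (b i) → ¬ M (b (i + 4)) := fun i h1 h2 h3 =>
    n8 (i + 4) h1 h3 (by simpa [add_assoc] using h2)
  have l1 : ∀ i j : Fin 5, i = j + 1 ↔ j = i + 4 := by decide
  by_cases hMz : M z
  · by_cases hMx : ∃ i, M (x i)
    · obtain ⟨i, hi⟩ := hMx
      refine n1 i hMz hi (hx _ fun p hp => ?_)
      have h1 := hl p z
      have h2 := hl p (x i)
      cases p <;> simp [Linked, Full] at h1 h2 ⊢ <;> grind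
    · push Not at hMx
      refine hMx 0 (hx 0 fun p hp => ?_)
      have h1 := hl p z
      cases p <;> simp [Linked, Full] at h1 ⊢ <;> grind
  by_cases hMt : M t
  · by_cases hMb : ∃ i, M (b i)
    · obtain ⟨i, hi⟩ := hMb
      obtain ⟨p, hp, hp1, hp2⟩ := n9 i hMt hi
      have h1 := hl p t
      have h2 := hl p (b i)
      cases p <;> simp [Linked, Full] at h1 h2 hp1 hp2 <;> grind
    · push Not at hMb
      refine hMz (hz fun p hp => ?_)
      have h1 := hl p t
      cases p <;> simp [Linked, Full] at h1 ⊢ <;> grind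
  by_cases hMa : ∃ i, M (a i)
  · obtain ⟨i, hi⟩ := hMa
    refine n4 i (i + 1) (Or.inl rfl) hi (hx _ fun p hp => ?_)
    have h1 := hl p (a i)
    cases p <;> simp [Linked, Full] at h1 ⊢ <;> grind
  push Not at hMa
  by_cases hMb : ∃ i, M (b i)
  · have hbb : ∀ i, M (b i) → ¬ M (b (i + 1)) := by
      intro i hi hi1
      refine n7 i hi hi1 (hx _ fun p hp => ?_)
      have h1 := hl p (b i)
      have h2 := hl p (b (i + 1))
      have l2 : ∀ i j : Fin 5, (j = i ∨ j = i + 2 ∨ j = i + 3) →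
        (j = i + 1 ∨ j = i + 1 + 2 ∨ j = i + 1 + 3) → j = i + 3 := by decide
      have l3 : ∀ i j : Fin 5, (i = j + 1 ∨ j = i + 1) →
        (i + 1 = j + 1 ∨ j = i + 1 + 1) → j = i := by decide
      cases p with
      | x j => simp [Linked, Full] at h1 h2 ⊢; grind
      | b j => simp [Linked, Full] at h1 h2 ⊢; have := l3 i j; grind
      | _ => simp [Linked, Full] at h1 h2 ⊢ <;> grind
    obtain ⟨i, hi⟩ := hMb
    have hb1 := hbb i hi
    have hb4 : ¬ M (b (i + 4)) := fun h => hbb (i + 4) h (by simpa [add_assoc] using hi)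
    have hb : ∀ j, M (b j) → j = i := by
      intro j hj
      have h1 := hl (b j) (b i)
      simp [Linked, Full] at h1
      grind
    by_cases hMx : M (x i)
    · obtain ⟨p, hp, hp1, hp2⟩ := n5 i hi hMx
      have h1 := hl p (b i)
      have h2 := hl p (x i)
      have l2 : ∀ i j : Fin 5, (j = i ∨ j = i + 2 ∨ j = i + 3) →
        (i = j + 1 ∨ j = i + 1) → False := by decide
      cases p with
      | x j => simp [Linked, Full] at h1 h2 hp1 hp2; have := l2 i j; grind
      | _ => simp [Linked, Full] at h1 h2 hp1 hp2; grind
    · have hp : ∀ p, M p → p = b i ∨ p = x (i + 2) ∨ p = x (i + 3) := by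
        intro p hp
        have h1 := hl p (b i)
        cases p <;> simp [Linked, Full] at h1 ⊢ <;> grind
      refine n6 i hi (hx _ fun p h => ?_) (hx _ fun p h => ?_) <;>
        rcases hp p h with rfl | rfl | rfl <;> simp [Full, add_assoc]
  push Not at hMb
  refine hMz (hz fun p hp => ?_)
  cases p <;> simp [Full] <;> grind

/-- At least two of three classes are coloured. -/
def PartIdx.TwoOf (c : PartIdx → Fin 4) (p q r : PartIdx) : Prop :=
  c p ≠ 0 ∧ c q ≠ 0 ∨ c p ≠ 0 ∧ c r ≠ 0 ∨ c q ≠ 0 ∧ c r ≠ 0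

namespace IsDecomp

variable {V : Type*} {G : SimpleGraph V} {P : PartIdx → Set V}

theorem inter_nonempty (D : IsDecomp G P) {K : Set V} (hK : Maximal G.IsClique K) {p : PartIdx}
    (hp : (P p).Nonempty) (hc : G.IsClique (P p))
    (h : ∀ q, (K ∩ P q).Nonempty → q = p ∨ Full q p) : (K ∩ P p).Nonempty := by
  obtain ⟨w, hw⟩ := hp
  refine ⟨w, hK.le_of_ge (y := insert w K) (hK.prop.insert fun u hu hwu => ?_)
    (Set.subset_insert w K) (Set.mem_insert w K), hw⟩
  obtain ⟨q, hq⟩ := D.cover u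
  rcases h q ⟨u, hu, hq⟩ with rfl | hf
  · exact hc hw hq hwu
  · exact (D.full q p u w hf hq hw).symm

theorem ncard_lt_cliqueNum [Finite V] (D : IsDecomp G P) {K : Set V} (hK : G.IsClique K)
    {i : Fin 5} (hKi : K ⊆ P (b i) ∪ P (x i))
    (h : (P (x i)).ncard < (P (x (i + 2))).ncard + (P (x (i + 3))).ncard) :
    K.ncard < G.cliqueNum := by
  have : Std.Symm G.Adj := ⟨fun _ _ e => e.symm⟩
  have hxx : Full (x (i + 2)) (x (i + 3)) := by simp [Full, add_assoc]
  have hb2 : Full (b i) (x (i + 2)) := by simp [Full]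
  have hb3 : Full (b i) (x (i + 3)) := by simp [Full]
  have h1 : G.IsClique (P (x (i + 2)) ∪ P (x (i + 3))) := by
    refine Set.pairwise_union_of_symm.2
      ⟨D.x_clique _, D.x_clique _, fun u hu w hw _ => D.full _ _ u w hxx hu hw⟩
  have h2 : G.IsClique (K ∩ P (b i) ∪ (P (x (i + 2)) ∪ P (x (i + 3)))) := by
    refine Set.pairwise_union_of_symm.2
      ⟨hK.subset Set.inter_subset_left, h1, fun u hu w hw _ => ?_⟩
    rcases hw with hw | hw
    exacts [D.full _ _ u w hb2 hu.2 hw, D.full _ _ u w hb3 hu.2 hw]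
  have h3 := h2.ncard_le_cliqueNum
  have d : ∀ p q, p ≠ q → Disjoint (P p) (P q) := fun p q hpq =>
    Set.disjoint_left.2 fun u => D.disj p q u hpq
  rw [Set.ncard_union_eq (Set.disjoint_union_right.2
      ⟨(d _ _ (by simp)).mono_left Set.inter_subset_right,
        (d _ _ (by simp)).mono_left Set.inter_subset_right⟩) (Set.toFinite _) (Set.toFinite _),
    Set.ncard_union_eq (d _ _ (by simp)) (Set.toFinite _) (Set.toFinite _)] at h3
  have h4 : K.ncard ≤ (K ∩ P (b i)).ncard + (P (x i)).ncard := by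
    refine (Set.ncard_le_ncard (t := K ∩ P (b i) ∪ P (x i)) (fun u hu => ?_)
      (Set.toFinite _)).trans (Set.ncard_union_le _ _)
    exact (hKi hu).imp (fun e => ⟨hu, e⟩) id
  omega

theorem isNice_of_classes [Finite V] (D : IsDecomp G P) (c : PartIdx → Fin 4)
    (hc : ∀ p q, (P p).Nonempty → (P q).Nonempty → Linked p q → c p = c q → c p = 0)
    (hzxx : ∀ i, TwoOf c z (x i) (x (i + 1)))
    (hzt : (P t).Nonempty → c z ≠ 0 ∧ c t ≠ 0)
    (hab : ∀ i, (P (a i)).Nonempty → (P (b i)).Nonempty → c (a i) ≠ 0 ∧ c (b i) ≠ 0)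
    (hax : ∀ i j, j = i + 1 ∨ j = i + 4 → (P (a i)).Nonempty → c (a i) ≠ 0 ∧ c (x j) ≠ 0)
    (hbx : ∀ i, (P (b i)).Nonempty → c (b i) ≠ 0 ∧ c (x i) ≠ 0 ∨ (c (b i) ≠ 0 ∨ c (x i) ≠ 0) ∧
      (P (x i)).ncard < (P (x (i + 2))).ncard + (P (x (i + 3))).ncard)
    (hbxx : ∀ i, (P (b i)).Nonempty → TwoOf c (b i) (x (i + 2)) (x (i + 3)))
    (hbbx : ∀ i, (P (b i)).Nonempty → (P (b (i + 1))).Nonempty →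
      TwoOf c (b i) (b (i + 1)) (x (i + 3)))
    (htbb : ∀ i, (P t).Nonempty → (P (b i)).Nonempty → (P (b (i + 1))).Nonempty →
      TwoOf c t (b i) (b (i + 1)))
    (htb : ∀ i, (P t).Nonempty → (P (b i)).Nonempty → c t ≠ 0 ∧ c (b i) ≠ 0 ∨
      ∃ w, w ∉ P t ∪ P (b i) ∧ ∀ u ∈ P t ∪ P (b i), G.Adj u w) : IsNice G := by
  refine D.isNice_of_colouring c hc fun K hK => ?_
  have two : ∀ p q r, p ≠ q → p ≠ r → q ≠ r → (K ∩ P p).Nonempty → (K ∩ P q).Nonempty →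
      (K ∩ P r).Nonempty → TwoOf c p q r →
      ∃ p q, p ≠ q ∧ (K ∩ P p).Nonempty ∧ (K ∩ P q).Nonempty ∧ c p ≠ 0 ∧ c q ≠ 0 := by
    rintro p q r hpq hpr hqr hp hq hr (⟨h1, h2⟩ | ⟨h1, h2⟩ | ⟨h1, h2⟩)
    exacts [⟨p, q, hpq, hp, hq, h1, h2⟩, ⟨p, r, hpr, hp, hr, h1, h2⟩,
      ⟨q, r, hqr, hq, hr, h1, h2⟩]
  have ne : ∀ p, (K ∩ P p).Nonempty → (P p).Nonempty := fun p h => h.mono Set.inter_subset_right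
  have hKne : ∃ p, (K ∩ P p).Nonempty := by
    obtain ⟨u, hu⟩ := D.z_nonempty
    have hne : K.Nonempty := by
      by_contra! h
      subst h
      exact hK.le_of_ge (y := {u}) (by simp) (Set.empty_subset _) (Set.mem_singleton u)
    obtain ⟨w, hw⟩ := hne
    obtain ⟨p, hp⟩ := D.cover w
    exact ⟨p, w, hw, hp⟩
  have sub : ∀ p q, (∀ r, (K ∩ P r).Nonempty → r = p ∨ r = q) → K ⊆ P p ∪ P q := by
    intro p q h u hu
    obtain ⟨r, hr⟩ := D.cover u
    rcases h r ⟨u, hu, hr⟩ with rfl | rfl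
    exacts [Or.inl hr, Or.inr hr]
  rcases PartIdx.patterns (fun p => (K ∩ P p).Nonempty) hKne
    (fun p q hpq hp hq => D.linked_of_clique hK.prop hpq hp hq)
    (fun i h => D.inter_nonempty hK (D.x_nonempty i) (D.x_clique i) h)
    (fun h => D.inter_nonempty hK D.z_nonempty D.z_clique h) with
    ⟨i, h1, h2, h3⟩ | ⟨h1, h2⟩ | ⟨i, h1, h2⟩ | ⟨i, j, hj, h1, h2⟩ | ⟨i, h1, h2, h3⟩ |
    ⟨i, h1, h2, h3⟩ | ⟨i, h1, h2, h3⟩ | ⟨i, h1, h2, h3⟩ | ⟨i, h1, h2, h3⟩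
  · exact Or.inl (two _ _ _ (by simp) (by simp) (by simp) h1 h2 h3 (hzxx i))
  · exact Or.inl ⟨z, t, by simp, h1, h2, hzt (ne _ h2)⟩
  · exact Or.inl ⟨a i, b i, by simp, h1, h2, hab i (ne _ h1) (ne _ h2)⟩
  · exact Or.inl ⟨a i, x j, by simp, h1, h2, hax i j hj (ne _ h1)⟩
  · rcases hbx i (ne _ h1) with h | ⟨h | h, hlt⟩
    · exact Or.inl ⟨b i, x i, by simp, h1, h2, h⟩
    · exact Or.inr ⟨b i, h1, h, D.ncard_lt_cliqueNum hK.prop (sub _ _ h3) hlt⟩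
    · exact Or.inr ⟨x i, h2, h, D.ncard_lt_cliqueNum hK.prop (sub _ _ h3) hlt⟩
  · exact Or.inl (two _ _ _ (by simp) (by simp) (by simp) h1 h2 h3 (hbxx i (ne _ h1)))
  · exact Or.inl (two _ _ _ (by simp) (by simp) (by simp) h1 h2 h3 (hbbx i (ne _ h1) (ne _ h2)))
  · exact Or.inl (two _ _ _ (by simp) (by simp) (by simp) h1 h2 h3
      (htbb i (ne _ h1) (ne _ h2) (ne _ h3)))
  · rcases htb i (ne _ h1) (ne _ h2) with h | ⟨w, hw, hwa⟩
    · exact Or.inl ⟨t, b i, by simp, h1, h2, h⟩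
    · have hs := sub _ _ h3
      exact absurd (hs (hK.le_of_ge (y := insert w K)
        (hK.prop.insert fun u hu _ => (hwa u (hs hu)).symm) (Set.subset_insert w K)
        (Set.mem_insert w K))) hw

end IsDecomp

/-- The colouring of the classes with prescribed values. -/
def PartIdx.colouring (cx ca cb : Fin 5 → Fin 4) (cz ct : Fin 4) : PartIdx → Fin 4
  | x i => cx i
  | a i => ca i
  | b i => cb i
  | z => cz
  | t => ct

namespace IsDecomp

variable {V : Type*} {G : SimpleGraph V} {P : PartIdx → Set V}

theorem isNice_of_t_empty [Finite V] (D : IsDecomp G P) (ht : ¬ (P t).Nonempty)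
    (h4 : (P (b 4)).Nonempty → ¬ (P (a 4)).Nonempty ∧
      (P (x 4)).ncard < (P (x 1)).ncard + (P (x 2)).ncard) : IsNice G := by
  refine D.isNice_of_classes
    (colouring ![1, 2, 1, 2, 3] ![1, 2, 1, 2, 3] ![3, 1, 2, 3, 0] 0 0)
    ?_ ?_ ?_ ?_ ?_ ?_ ?_ ?_ ?_ ?_
  · rintro (i | i | i | _ | _) (j | j | j | _ | _) - - <;> simp only [Linked, Full, colouring] <;>
      first | (revert i j; decide) | (revert i; decide) | (revert j; decide) | decide
  · simp only [TwoOf, colouring]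
    decide
  · exact fun h => absurd h ht
  · intro i ha hb
    fin_cases i
    all_goals first | (exact absurd ha (h4 hb).1) | simp [colouring]
  · intro i j hj ha
    clear ha
    simp only [colouring]
    revert i j
    decide
  · intro i hb
    fin_cases i
    all_goals first | (exact Or.inr ⟨by simp [colouring], (h4 hb).2⟩) | simp [colouring]
  · intro i h
    clear h
    simp only [TwoOf, colouring]
    revert i
    decide
  · intro i h h'
    clear h h'
    simp only [TwoOf, colouring]
    revert i
    decide
  · exact fun i h => absurd h ht
  · exact fun i h => absurd h ht

theorem isNice_of_b_empty [Finite V] (D : IsDecomp G P) (h4 : ¬ (P (b 4)).Nonempty)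
    (h23 : ¬ (P (b 2)).Nonempty ∨ ¬ (P (b 3)).Nonempty) (ha0 : ¬ (P (a 0)).Nonempty)
    (ha3 : ¬ (P (a 3)).Nonempty) : IsNice G := by
  refine D.isNice_of_classes
    (colouring ![1, 2, 1, 2, 0] ![0, 2, 1, 0, 3] ![3, 1, 3, 3, 0] 3 2)
    ?_ ?_ ?_ ?_ ?_ ?_ ?_ ?_ ?_ ?_
  · rintro (i | i | i | _ | _) (j | j | j | _ | _) hp hq
    all_goals simp only [Linked, Full, colouring]
    case b.b =>
      have key : ∀ i j : Fin 5, j = i + 1 ∨ i = j + 1 →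
        ![3, 1, 3, 3, 0] i = (![3, 1, 3, 3, 0] j : Fin 4) → ![3, 1, 3, 3, 0] i = (0 : Fin 4) ∨
        i = 2 ∧ j = 3 ∨ i = 3 ∧ j = 2 := by decide
      intro h1 h2
      rcases key i j h1 h2 with h | ⟨rfl, rfl⟩ | ⟨rfl, rfl⟩
      · exact h
      · exact (h23.elim (absurd hp) (absurd hq))
      · exact (h23.elim (absurd hq) (absurd hp))
    all_goals
      clear hp hq
      first | (revert i j; decide) | (revert i; decide) | (revert j; decide) | decide
  · simp only [TwoOf, colouring]
    decide
  · simp [colouring]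
  · intro i ha hb
    fin_cases i
    all_goals first | (exact absurd ha ha0) | (exact absurd ha ha3) | (exact absurd hb h4) |
      simp [colouring]
  · intro i j hj ha
    have key : ∀ i j : Fin 5, j = i + 1 ∨ j = i + 4 → i ≠ 0 → i ≠ 3 →
        ![0, 2, 1, 0, 3] i ≠ (0 : Fin 4) ∧ ![1, 2, 1, 2, 0] j ≠ (0 : Fin 4) := by decide
    exact key i j hj (by rintro rfl; exact ha0 ha) (by rintro rfl; exact ha3 ha)
  · intro i hb
    fin_cases i
    all_goals first | (exact absurd hb h4) | simp [colouring]
  · intro i hb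
    fin_cases i
    all_goals first | (exact absurd hb h4) | (simp only [TwoOf, colouring]; decide)
  · intro i hb hb'
    fin_cases i
    all_goals first | (exact absurd hb h4) | (exact absurd hb' h4) |
      (simp only [TwoOf, colouring]; decide)
  · intro i _ hb hb'
    fin_cases i
    all_goals first | (exact absurd hb h4) | (exact absurd hb' h4) |
      (simp only [TwoOf, colouring]; decide)
  · intro i _ hb
    fin_cases i
    all_goals first | (exact absurd hb h4) | simp [colouring]

theorem isNice_of_t_b_complete [Finite V] (D : IsDecomp G P) (ha : ∀ i, ¬ (P (a i)).Nonempty)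
    (ht : ∀ i, ∀ u ∈ P t, ∀ w ∈ P (b i), G.Adj u w)
    (hb : (P (b 1)).Nonempty ∨ (P (b 3)).Nonempty)
    (h1 : (P (x 1)).ncard < (P (x 3)).ncard + (P (x 4)).ncard)
    (h2 : (P (x 2)).ncard < (P (x 4)).ncard + (P (x 0)).ncard)
    (h3 : (P (x 3)).ncard < (P (x 0)).ncard + (P (x 1)).ncard) : IsNice G := by
  refine D.isNice_of_classes
    (colouring ![1, 0, 1, 0, 3] (fun _ => 0) ![3, 2, 0, 3, 2] 2 1)
    ?_ ?_ ?_ ?_ ?_ ?_ ?_ ?_ ?_ ?_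
  · rintro (i | i | i | _ | _) (j | j | j | _ | _) - - <;> simp only [Linked, Full, colouring] <;>
      first | (revert i j; decide) | (revert i; decide) | (revert j; decide) | decide
  · simp only [TwoOf, colouring]
    decide
  · simp [colouring]
  · exact fun i h => absurd h (ha i)
  · exact fun i j _ h => absurd h (ha i)
  · intro i _
    fin_cases i
    all_goals first | (exact Or.inr ⟨by simp [colouring], h1⟩) |
      (exact Or.inr ⟨by simp [colouring], h2⟩) | (exact Or.inr ⟨by simp [colouring], h3⟩) |
      simp [colouring]
  · intro i h
    clear h
    simp only [TwoOf, colouring]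
    revert i
    decide
  · intro i h h'
    clear h h'
    simp only [TwoOf, colouring]
    revert i
    decide
  · intro i h h' h''
    clear h h' h''
    simp only [TwoOf, colouring]
    revert i
    decide
  · have key : ∀ i, Full (b 2) (b i) → (P (b i)).Nonempty →
        ∃ w, w ∉ P t ∪ P (b 2) ∧ ∀ u ∈ P t ∪ P (b 2), G.Adj u w := by
      rintro i hf ⟨w, hw⟩
      refine ⟨w, ?_, ?_⟩
      · rintro (h | h)
        · exact D.disj t (b i) w (by simp) h hw
        · exact G.irrefl (D.full _ _ w w hf h hw)
      · rintro u (h | h)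
        exacts [ht i u h w hw, D.full _ _ u w hf h hw]
    intro i _ _
    fin_cases i
    all_goals first
      | exact Or.inr (hb.elim (key 1 (by simp [Full])) (key 3 (by simp [Full])))
      | simp [colouring]

end IsDecomp

/-- The map `v` traverses a chordless 5-cycle in the neighbourhood of `z`. -/
def IsFrame {V : Type*} (G : SimpleGraph V) (z : V) (v : Fin 5 → V) : Prop :=
  ∀ i, IsWheel G z (v i) (v (i + 1)) (v (i + 2)) (v (i + 3)) (v (i + 4))

/-- The classes of vertices with respect to a 5-wheel with hub `c` and rim `v`. -/
def part {V : Type*} (G : SimpleGraph V) (c : V) (v : Fin 5 → V) : PartIdx → Set V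
  | x i => {u | IsX G c (v i) (v (i + 1)) (v (i + 2)) (v (i + 3)) (v (i + 4)) u}
  | a i => {u | IsA G c (v i) (v (i + 1)) (v (i + 2)) (v (i + 3)) (v (i + 4)) u}
  | b i => {u | IsB G c (v i) (v (i + 1)) (v (i + 2)) (v (i + 3)) (v (i + 4)) u}
  | z => {u | ∀ i, G.Adj u (v i)}
  | t => {u | ∀ i, ¬ G.Adj u (v i)}

namespace IsFrame

variable {V : Type*} {G : SimpleGraph V} {c : V} {v : Fin 5 → V}

theorem isZ_of_mem {u : V} (hu : u ∈ part G c v z) (i : Fin 5) :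
    IsZ G (v i) (v (i + 1)) (v (i + 2)) (v (i + 3)) (v (i + 4)) u :=
  ⟨hu _, hu _, hu _, hu _, hu _⟩

theorem isT_of_mem {u : V} (hu : u ∈ part G c v t) (i : Fin 5) :
    IsT G (v i) (v (i + 1)) (v (i + 2)) (v (i + 3)) (v (i + 4)) u :=
  ⟨hu _, hu _, hu _, hu _, hu _⟩

theorem hub_mem (h : IsFrame G c v) : c ∈ part G c v z := fun i => (h i).z0

theorem rim_mem (h : IsFrame G c v) (i : Fin 5) : v i ∈ part G c v (x i) :=
  have h := h i
  ⟨Or.inl rfl, h.z0.symm, h.a01, h.a40.symm, h.n02, fun e => h.n30 e.symm⟩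

theorem fin_five_cases (k : Fin 5) : k = 0 ∨ k = 1 ∨ k = 2 ∨ k = 3 ∨ k = 4 := by
  revert k; decide

theorem cover (F : P5W4Free G) (h : IsFrame G c v) (u : V) : ∃ p, u ∈ part G c v p := by
  have h0 := (h 0).classify F u
  simp only [zero_add] at h0
  rcases h0 with h0 | h0 | h0 | h0 | h0 | h0 | h0
  · refine ⟨z, fun i => ?_⟩
    obtain ⟨h0, h1, h2, h3, h4⟩ := h0
    fin_cases i <;> assumption
  · refine ⟨t, fun i => ?_⟩
    obtain ⟨h0, h1, h2, h3, h4⟩ := h0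
    fin_cases i <;> assumption
  · exact h0.elim (fun e => ⟨x 0, e⟩) (fun e => e.elim (fun e => ⟨a 0, e⟩) (fun e => ⟨b 0, e⟩))
  · exact h0.elim (fun e => ⟨x 1, e⟩) (fun e => e.elim (fun e => ⟨a 1, e⟩) (fun e => ⟨b 1, e⟩))
  · exact h0.elim (fun e => ⟨x 2, e⟩) (fun e => e.elim (fun e => ⟨a 2, e⟩) (fun e => ⟨b 2, e⟩))
  · exact h0.elim (fun e => ⟨x 3, e⟩) (fun e => e.elim (fun e => ⟨a 3, e⟩) (fun e => ⟨b 3, e⟩))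
  · exact h0.elim (fun e => ⟨x 4, e⟩) (fun e => e.elim (fun e => ⟨a 4, e⟩) (fun e => ⟨b 4, e⟩))

theorem disj (p q : PartIdx) (u : V) (hpq : p ≠ q) (hp : u ∈ part G c v p) :
    u ∉ part G c v q := by
  intro hq
  have key : ∀ {i j : Fin 5}, i ≠ j → ∃ k, k ≠ 0 ∧ j = i + k := fun {i j} hij =>
    ⟨j - i, sub_ne_zero.2 hij.symm, by simp⟩
  have cases_ab : ∀ i j, u ∈ part G c v (a i) → u ∉ part G c v (b j) := by
    intro i j hp hq
    obtain ⟨k, rfl⟩ : ∃ k, j = i + k := ⟨j - i, by simp⟩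
    rcases fin_five_cases k with rfl | rfl | rfl | rfl | rfl <;>
      simp [part, add_assoc, IsA, IsB] at hp hq <;> tauto
  rcases p with i | i | i | _ | _ <;> rcases q with j | j | j | _ | _
  case a.b => exact cases_ab i j hp hq
  case b.a => exact cases_ab j i hq hp
  case x.x | a.a | b.b =>
    obtain ⟨k, hk, rfl⟩ := key (i := i) (j := j) (by rintro rfl; exact hpq rfl)
    rcases fin_five_cases k with rfl | rfl | rfl | rfl | rfl <;>
      simp [part, add_assoc, IsX, IsA, IsB] at hp hq hk <;> tauto
  case x.a | x.b => exact hq.2.1 hp.2.1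
  case a.x | b.x => exact hp.2.1 hq.2.1
  case x.z => exact hp.2.2.2.2.1 (hq _)
  case z.x => exact hq.2.2.2.2.1 (hp _)
  case x.t => exact hq _ hp.2.2.1
  case t.x => exact hp _ hq.2.2.1
  case a.z => exact hp.1 (hq _)
  case z.a => exact hq.1 (hp _)
  case a.t => exact hq _ hp.2.2.1
  case t.a => exact hp _ hq.2.2.1
  case b.z => exact hp.2.2.1 (hq _)
  case z.b => exact hq.2.2.1 (hp _)
  case b.t => exact hq _ hp.1
  case t.b => exact hp _ hq.1
  case z.z | t.t => exact hpq rfl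
  case z.t => exact hq 0 (hp 0)
  case t.z => exact hp 0 (hq 0)

/-- The relation between two given classes of vertices is as prescribed. -/
def Rel (G : SimpleGraph V) (p q : PartIdx) (u w : V) : Prop :=
  (Full p q → G.Adj u w) ∧ (¬ Linked p q → ¬ G.Adj u w)

theorem Rel.symm {p q : PartIdx} {u w : V} (h : Rel G p q u w) : Rel G q p w u := by
  refine ⟨fun e => (h.1 e.symm).symm, fun e e' => h.2 (fun hl => e ?_) e'.symm⟩
  cases p <;> cases q <;> simp_all [Linked, Full, or_comm]

theorem rel_x_x (F : P5W4Free G) (h : IsFrame G c v) {i k : Fin 5} {u w : V} (hk : k ≠ 0)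
    (hu : u ∈ part G c v (x i)) (hw : w ∈ part G c v (x (i + k))) :
    Rel G (x i) (x (i + k)) u w := by
  have h3 := h (i + 3)
  have h4 := h (i + 4)
  rcases fin_five_cases k with rfl | rfl | rfl | rfl | rfl <;>
    simp [part, add_assoc, Rel, Linked, Full] at *
  · exact (h i).x_x_one F hu hw
  · exact (h i).x_x_two F hu hw
  · exact fun e => h3.x_x_two F hw hu e.symm
  · exact (h4.x_x_one F hw hu).symm

theorem rel_a_x (F : P5W4Free G) (h : IsFrame G c v) {i k : Fin 5} {u w : V}
    (hu : u ∈ part G c v (a i)) (hw : w ∈ part G c v (x (i + k))) :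
    Rel G (a i) (x (i + k)) u w := by
  rcases fin_five_cases k with rfl | rfl | rfl | rfl | rfl <;>
    simp [part, add_assoc, Rel, Linked, Full] at *
  · exact (h i).a_x_zero F hu hw
  · exact (h i).a_x_one F hu hw
  · exact (h i).a_x_two F hu hw
  · exact (h i).a_x_three F hu hw
  · exact (h i).a_x_four F hu hw

theorem rel_b_x (F : P5W4Free G) (h : IsFrame G c v) {i k : Fin 5} {u w : V}
    (hu : u ∈ part G c v (b i)) (hw : w ∈ part G c v (x (i + k))) :
    Rel G (b i) (x (i + k)) u w := by
  rcases fin_five_cases k with rfl | rfl | rfl | rfl | rfl <;>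
    simp [part, add_assoc, Rel, Linked, Full] at *
  · exact (h i).b_x_zero F hu hw
  · exact (h i).b_x_one F hu hw
  · exact (h i).b_x_two F hu hw
  · exact (h i).b_x_three F hu hw
  · exact (h i).b_x_four F hu hw

theorem rel_a_b (F : P5W4Free G) (h : IsFrame G c v) {i k : Fin 5} {u w : V}
    (hu : u ∈ part G c v (a i)) (hw : w ∈ part G c v (b (i + k))) :
    Rel G (a i) (b (i + k)) u w := by
  rcases fin_five_cases k with rfl | rfl | rfl | rfl | rfl <;>
    simp [part, add_assoc, Rel, Linked, Full] at *
  · exact (h i).a_b_zero F hu hw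
  · exact (h i).a_b_one F hu hw
  · exact (h i).a_b_two F hu hw
  · exact (h i).a_b_three F hu hw
  · exact (h i).a_b_four F hu hw

theorem rel_a_a (F : P5W4Free G) (h : IsFrame G c v) {i k : Fin 5} {u w : V} (hk : k ≠ 0)
    (hu : u ∈ part G c v (a i)) (hw : w ∈ part G c v (a (i + k))) :
    Rel G (a i) (a (i + k)) u w := by
  have h3 := h (i + 3)
  have h4 := h (i + 4)
  rcases fin_five_cases k with rfl | rfl | rfl | rfl | rfl <;>
    simp [part, add_assoc, Rel, Linked, Full] at *
  · exact ((h i).a_a_one F hu hw).elim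
  · exact (h i).a_a_two F hu hw
  · exact fun e => h3.a_a_two F hw hu e.symm
  · exact (h4.a_a_one F hw hu).elim

theorem rel_b_b (F : P5W4Free G) (h : IsFrame G c v) {i k : Fin 5} {u w : V} (hk : k ≠ 0)
    (hu : u ∈ part G c v (b i)) (hw : w ∈ part G c v (b (i + k))) :
    Rel G (b i) (b (i + k)) u w := by
  have h3 := h (i + 3)
  have h4 := h (i + 4)
  rcases fin_five_cases k with rfl | rfl | rfl | rfl | rfl <;>
    simp [part, add_assoc, Rel, Linked, Full] at *
  · exact (h i).b_b_one F hu hw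
  · exact (h i).b_b_two F hu hw
  · exact fun e => h3.b_b_two F hw hu e.symm
  · exact (h4.b_b_one F hw hu).symm

/-- Distinct classes are related as prescribed if every vertex without neighbours on the rim has a
neighbour in some class `b i`. -/
theorem rel (F : P5W4Free G) (h : IsFrame G c v)
    (hT : ∀ u ∈ part G c v t, ∃ i, ∃ w ∈ part G c v (b i), G.Adj u w) (p q : PartIdx) (u w : V)
    (hpq : p ≠ q) (hu : u ∈ part G c v p) (hw : w ∈ part G c v q) : Rel G p q u w := by
  have key : ∀ i j : Fin 5, ∃ k, j = i + k := fun i j => ⟨j - i, by simp⟩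
  have key' : ∀ {i j : Fin 5}, i ≠ j → ∃ k, k ≠ 0 ∧ j = i + k := fun {i j} hij =>
    ⟨j - i, sub_ne_zero.2 hij.symm, by simp⟩
  have hax : ∀ i j u w, u ∈ part G c v (a i) → w ∈ part G c v (x j) → Rel G (a i) (x j) u w := by
    intro i j u w hu hw
    obtain ⟨k, rfl⟩ := key i j
    exact h.rel_a_x F hu hw
  have hbx : ∀ i j u w, u ∈ part G c v (b i) → w ∈ part G c v (x j) → Rel G (b i) (x j) u w := by
    intro i j u w hu hw
    obtain ⟨k, rfl⟩ := key i j
    exact h.rel_b_x F hu hw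
  have hab : ∀ i j u w, u ∈ part G c v (a i) → w ∈ part G c v (b j) → Rel G (a i) (b j) u w := by
    intro i j u w hu hw
    obtain ⟨k, rfl⟩ := key i j
    exact h.rel_a_b F hu hw
  have hzx : ∀ i u w, u ∈ part G c v z → w ∈ part G c v (x i) → Rel G z (x i) u w :=
      fun i u w hu hw =>
    ⟨fun _ => (h i).hub_x F (isZ_of_mem hu i) hw, fun e => (e trivial).elim⟩
  have hza : ∀ i u w, u ∈ part G c v z → w ∈ part G c v (a i) → Rel G z (a i) u w :=
      fun i u w hu hw =>
    ⟨False.elim, fun _ => (h i).hub_a F (isZ_of_mem hu i) hw⟩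
  have hzb : ∀ i u w, u ∈ part G c v z → w ∈ part G c v (b i) → Rel G z (b i) u w :=
      fun i u w hu hw =>
    ⟨False.elim, fun _ => (h i).hub_b F (isZ_of_mem hu i) hw⟩
  have hxt : ∀ i u w, u ∈ part G c v (x i) → w ∈ part G c v t → Rel G (x i) t u w :=
      fun i u w hu hw =>
    ⟨False.elim, fun _ => (h i).x_t F hu (isT_of_mem hw i)⟩
  have hat : ∀ i u w, u ∈ part G c v (a i) → w ∈ part G c v t → Rel G (a i) t u w :=
      fun i u w hu hw =>
    ⟨False.elim, fun _ => (h i).a_t F hu (isT_of_mem hw i)⟩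
  have hbt : ∀ i u w, u ∈ part G c v (b i) → w ∈ part G c v t → Rel G (b i) t u w :=
      fun i u w hu hw =>
    ⟨False.elim, fun e => (e trivial).elim⟩
  have htz : ∀ u w, u ∈ part G c v t → w ∈ part G c v z → Rel G t z u w := by
    refine fun u w hu hw => ⟨fun _ => ?_, fun e => (e trivial).elim⟩
    obtain ⟨i, r, hr, hur⟩ := hT u hu
    exact (h i).t_hub F hr (isT_of_mem hu i) (isZ_of_mem hw i) hur
  rcases p with i | i | i | _ | _ <;> rcases q with j | j | j | _ | _
  case z.z | t.t => exact absurd rfl hpq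
  case x.x =>
    obtain ⟨k, hk, rfl⟩ := key' (i := i) (j := j) (by rintro rfl; exact hpq rfl)
    exact h.rel_x_x F hk hu hw
  case a.a =>
    obtain ⟨k, hk, rfl⟩ := key' (i := i) (j := j) (by rintro rfl; exact hpq rfl)
    exact h.rel_a_a F hk hu hw
  case b.b =>
    obtain ⟨k, hk, rfl⟩ := key' (i := i) (j := j) (by rintro rfl; exact hpq rfl)
    exact h.rel_b_b F hk hu hw
  case a.x => exact hax _ _ _ _ hu hw
  case b.x => exact hbx _ _ _ _ hu hw
  case a.b => exact hab _ _ _ _ hu hw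
  case z.x => exact hzx _ _ _ hu hw
  case z.a => exact hza _ _ _ hu hw
  case z.b => exact hzb _ _ _ hu hw
  case x.t => exact hxt _ _ _ hu hw
  case a.t => exact hat _ _ _ hu hw
  case b.t => exact hbt _ _ _ hu hw
  case t.z => exact htz _ _ hu hw
  case x.a => exact (hax _ _ _ _ hw hu).symm
  case x.b => exact (hbx _ _ _ _ hw hu).symm
  case b.a => exact (hab _ _ _ _ hw hu).symm
  case x.z => exact (hzx _ _ _ hw hu).symm
  case a.z => exact (hza _ _ _ hw hu).symm
  case b.z => exact (hzb _ _ _ hw hu).symm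
  case t.x => exact (hxt _ _ _ hw hu).symm
  case t.a => exact (hat _ _ _ hw hu).symm
  case t.b => exact (hbt _ _ _ hw hu).symm
  case z.t => exact (htz _ _ hw hu).symm

theorem isDecomp (F : P5W4Free G) (h : IsFrame G c v)
    (hT : ∀ u ∈ part G c v t, ∃ i, ∃ w ∈ part G c v (b i), G.Adj u w) :
    IsDecomp G (part G c v) where
  cover := h.cover F
  anti p q u w hpq hl hu hw := (h.rel F hT p q u w hpq hu hw).2 hl
  full p q u w hf hu hw := (h.rel F hT p q u w
    (by rintro rfl; cases p <;> simp [Full] at hf) hu hw).1 hf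
  disj := disj
  x_clique i u hu w hw huw := ((h i).x_x_zero F hu hw).resolve_left huw
  z_clique u hu w hw huw :=
    ((h 0).hub_hub F (isZ_of_mem hu 0) (isZ_of_mem hw 0)).resolve_left huw
  x_nonempty i := ⟨v i, h.rim_mem i⟩
  z_nonempty := ⟨c, h.hub_mem⟩
  homog p s u w hs hu hsu hwu hws := by
    obtain ⟨q, hq⟩ := h.cover F w
    by_cases hqp : q = p
    · subst hqp
      cases q with
      | x i => exact ((h i).x_x_zero F hq hs).resolve_left hws
      | a i => exact (h i).a_trans F hq hu hs hwu hsu.symm hws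
      | b i => exact (h i).b_trans F hq hu hs hwu hsu.symm hws
      | z => exact ((h 0).hub_hub F (isZ_of_mem hq 0) (isZ_of_mem hs 0)).resolve_left hws
      | t =>
        obtain ⟨i, r, hr, hwr⟩ := hT w hq
        exact (h i).t_trans F hr (isT_of_mem hq i) (isT_of_mem hu i) (isT_of_mem hs i) hwr hwu
          hsu.symm hws
    · by_cases hf : Full q p
      · exact (h.rel F hT q p w s hqp hq hs).1 hf
      · have hl : Linked q p := by
          by_contra hl
          exact (h.rel F hT q p w u hqp hq hu).2 hl hwu
        rcases p with i | i | i | _ | _ <;> rcases q with j | j | j | _ | _ <;>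
          simp only [Linked, hf] at hl
        · exact (h i).t_b_of_b_adj F hu hs (isT_of_mem hq i) hsu.symm hwu
        · exact ((h j).t_b_of_t_adj F hq (isT_of_mem hu j) (isT_of_mem hs j) hsu.symm hwu.symm).symm

end IsFrame

theorem wheel_adj_inl {k : ℕ} (i j : Fin k) :
    (wheel k).Adj (Sum.inl i) (Sum.inl j) ↔ (cycleGraph k).Adj i j := by
  simp only [wheel, fromRel_adj]
  constructor
  · rintro ⟨-, (⟨i', j', h1, h2, h⟩ | h) | (⟨i', j', h1, h2, h⟩ | h)⟩
    · cases h1; cases h2; exact h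
    · simp at h
    · cases h1; cases h2; exact h.symm
    · simp at h
  · exact fun h => ⟨fun e => h.ne (Sum.inl_injective e), Or.inl (Or.inl ⟨i, j, rfl, rfl, h⟩)⟩

theorem wheel_adj_inr {k : ℕ} (i : Fin k) (u : Unit) : (wheel k).Adj (Sum.inr u) (Sum.inl i) := by
  simp [wheel]

theorem P5W4Free.of_inducedFree {V : Type*} {G : SimpleGraph V} (hP : InducedFree (pathGraph 5) G)
    (hW : InducedFree (wheel 4) G) : P5W4Free G where
  p5 a b c d e hab hbc hcd hde nac nad nae nbd nbe nce := by
    have adj : ∀ i j, G.Adj (![a, b, c, d, e] i) (![a, b, c, d, e] j) ↔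
        (pathGraph 5).Adj i j := by
      intro i j
      fin_cases i <;> fin_cases j <;> simp [pathGraph_adj] <;> grind [G.adj_comm]
    have inj : Function.Injective ![a, b, c, d, e] := by
      have h1 : a ≠ c := by rintro rfl; exact nad hcd
      have h2 : a ≠ d := by rintro rfl; exact nae hde
      have h3 : a ≠ e := by rintro rfl; exact nbe hab.symm
      have h4 : b ≠ d := by rintro rfl; exact nbe hde
      have h5 : b ≠ e := by rintro rfl; exact nae hab
      have h6 : c ≠ e := by rintro rfl; exact nbe hbc
      have := hab.ne
      have := hbc.ne
      have := hcd.ne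
      have := hde.ne
      intro i j hij
      fin_cases i <;> fin_cases j <;> simp_all
    exact hP.false ⟨⟨_, inj⟩, fun {i j} => adj i j⟩
  w4 m a b c d hma hmb hmc hmd hab hbc hcd hda nac nbd := by
    by_contra! hne
    obtain ⟨hac, hbd⟩ := hne
    have adj : ∀ i j, G.Adj (![a, b, c, d] i) (![a, b, c, d] j) ↔ (cycleGraph 4).Adj i j := by
      intro i j
      rw [cycleGraph_adj]
      fin_cases i <;> fin_cases j <;> simp_all [G.adj_comm] <;> decide
    have adj' : ∀ i, G.Adj m (![a, b, c, d] i) := by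
      intro i
      fin_cases i <;> assumption
    have inj : Function.Injective ![a, b, c, d] := by
      have := hab.ne
      have := hbc.ne
      have := hcd.ne
      have := hda.ne
      intro i j hij
      fin_cases i <;> fin_cases j <;> simp_all
    have inj' : Function.Injective (Sum.elim ![a, b, c, d] fun _ : Unit => m) :=
      inj.sumElim (Function.injective_of_subsingleton _) fun i _ => (adj' i).ne'
    refine hW.false ⟨⟨_, inj'⟩, ?_⟩
    rintro (i | i) (j | j)
    · exact (adj i j).trans (wheel_adj_inl i j).symm
    · exact iff_of_true (adj' i).symm (wheel_adj_inr i j).symm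
    · exact iff_of_true (adj' j) (wheel_adj_inr j i)
    · exact iff_of_false (G.irrefl) ((wheel 4).irrefl)

theorem exists_isFrame {V : Type*} {G : SimpleGraph V} (h : Nonempty (wheel 5 ↪g G)) :
    ∃ c v, IsFrame G c v := by
  obtain ⟨φ⟩ := h
  have adj : ∀ i j : Fin 5, G.Adj (φ (Sum.inl i)) (φ (Sum.inl j)) ↔ (cycleGraph 5).Adj i j :=
    fun i j => φ.map_adj_iff.trans (wheel_adj_inl i j)
  have hub : ∀ i : Fin 5, G.Adj (φ (Sum.inr ())) (φ (Sum.inl i)) := fun i =>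
    φ.map_adj_iff.2 (wheel_adj_inr i ())
  refine ⟨φ (Sum.inr ()), fun i => φ (Sum.inl i), fun i => ?_⟩
  constructor
  all_goals first | exact hub _ | (rw [adj, cycleGraph_adj]; revert i; decide)

/-- In an atom, every vertex without neighbours on the rim of a 5-wheel has a neighbour in some
class `b i`. -/
theorem IsFrame.exists_adj_b {V : Type*} [Finite V] {G : SimpleGraph V} {c : V} {v : Fin 5 → V}
    (F : P5W4Free G) (h : IsFrame G c v) (hconn : G.Connected) (hatom : IsGraphAtom G) :
    ∀ u ∈ part G c v t, ∃ i, ∃ w ∈ part G c v (b i), G.Adj u w := by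
  by_contra! hS
  obtain ⟨s, hs, hsb⟩ := hS
  refine hatom ⟨part G c v z, ?_, ?_⟩
  · exact fun u hu w hw huw =>
      ((h 0).hub_hub F (isZ_of_mem hu 0) (isZ_of_mem hw 0)).resolve_left huw
  have hH : G.Connected → Nat.card G.ConnectedComponent = 1 := by
    intro hc
    have := hc.preconnected.subsingleton_connectedComponent
    have := hc.nonempty
    exact Nat.card_eq_one_iff_unique.2 ⟨inferInstance, ⟨G.connectedComponentMk hc.nonempty.some⟩⟩
  rw [hH hconn, Finite.one_lt_card_iff_nontrivial]
  let S : Set V := {u | u ∈ part G c v t ∧ ∀ i, ∀ w ∈ part G c v (b i), ¬ G.Adj u w}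
  have closed : ∀ u w, u ∈ S → w ∉ part G c v z → G.Adj u w → w ∈ S := by
    rintro u w ⟨hu, hub⟩ hw huw
    obtain ⟨p, hp⟩ := h.cover F w
    cases p with
    | x i => exact ((h i).x_t F hp (isT_of_mem hu i) huw.symm).elim
    | a i => exact ((h i).a_t F hp (isT_of_mem hu i) huw.symm).elim
    | b i => exact (hub i w hp huw).elim
    | z => exact (hw hp).elim
    | t =>
      refine ⟨hp, fun i r hr hwr => hub i r hr ?_⟩
      exact (h i).t_b_of_t_adj F hr (isT_of_mem hp i) (isT_of_mem hu i) huw.symm hwr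
  have hsz : s ∉ part G c v z := fun e => hs 0 (e 0)
  have hvz : v 0 ∉ part G c v z := fun e => (e 0).ne rfl
  refine ⟨(G.induce (part G c v z)ᶜ).connectedComponentMk ⟨s, hsz⟩,
    (G.induce (part G c v z)ᶜ).connectedComponentMk ⟨v 0, hvz⟩, fun e => ?_⟩
  obtain ⟨W⟩ := ConnectedComponent.exact e
  have walk : ∀ {u w} (_ : (G.induce (part G c v z)ᶜ).Walk u w), u.1 ∈ S → w.1 ∈ S := by
    intro u w W
    induction W with
    | nil => exact id
    | @cons _ w _ huw _ ih => exact fun hu => ih (closed _ _ hu w.2 huw)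
  exact (walk W ⟨hs, hsb⟩).1 1 (h 0).a01

namespace IsFrame

variable {V : Type*} {G : SimpleGraph V} {c : V} {v : Fin 5 → V}

theorem rotate (h : IsFrame G c v) (r : Fin 5) : IsFrame G c fun i => v (i + r) := fun i => by
  simpa [add_right_comm] using h (i + r)

theorem part_rotate_x (r i : Fin 5) :
    part G c (fun i => v (i + r)) (x i) = part G c v (x (i + r)) := by
  simp [part, add_right_comm]

theorem part_rotate_a (r i : Fin 5) :
    part G c (fun i => v (i + r)) (a i) = part G c v (a (i + r)) := by
  simp [part, add_right_comm]

theorem part_rotate_b (r i : Fin 5) :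
    part G c (fun i => v (i + r)) (b i) = part G c v (b (i + r)) := by
  simp [part, add_right_comm]

theorem part_rotate_t (r : Fin 5) : part G c (fun i => v (i + r)) t = part G c v t :=
  Set.ext fun _ => ⟨fun hu i => by simpa using hu (i - r), fun hu _ => hu _⟩

theorem isDecomp_rotate [Finite V] (F : P5W4Free G) (h : IsFrame G c v)
    (hconn : G.Connected) (hatom : IsGraphAtom G) (r : Fin 5) :
    IsDecomp G (part G c fun i => v (i + r)) :=
  (h.rotate r).isDecomp F ((h.rotate r).exists_adj_b F hconn hatom)

end IsFrame

theorem forall_fin_five {p : Fin 5 → Prop} : (∀ i, p i) ↔ p 0 ∧ p 1 ∧ p 2 ∧ p 3 ∧ p 4 := by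
  simp [Fin.forall_fin_succ]

theorem exists_lt_add_of_not_consecutive (n : Fin 5 → ℕ) (hn : ∀ i, 0 < n i) (α : Fin 5 → Prop)
    (hα : ∀ i, ¬ (α i ∧ α (i + 1))) : ∃ j, ¬ α j ∧ n j < n (j + 2) + n (j + 3) := by
  by_contra! h
  simp only [forall_fin_five, Fin.reduceAdd] at h hα hn
  by_cases h0 : α 0 <;> by_cases h1 : α 1 <;> by_cases h2 : α 2 <;> by_cases h3 : α 3 <;>
    by_cases h4 : α 4 <;> simp [h0, h1, h2, h3, h4] at h hα <;> omega

theorem exists_lt_add_three (n : Fin 5 → ℕ) (hn : ∀ i, 0 < n i) :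
    ∃ r, n (1 + r) < n (3 + r) + n (4 + r) ∧ n (2 + r) < n (4 + r) + n (0 + r) ∧
      n (3 + r) < n (0 + r) + n (1 + r) := by
  by_contra! h
  simp only [forall_fin_five, Fin.reduceAdd] at h hn
  omega

theorem exists_not_or_forall_ne (α β N : Fin 5 → Prop) (hβ : ∀ i, N i → β i) (hN : ∃ i, N i)
    (h₁ : ∀ i, α i → β i → N i) (h₂ : ∀ i, α i → ¬ N (i + 2)) (h₃ : ∀ i, α i → ¬ N (i + 3))
    (hα : ∀ i, ¬ (α i ∧ α (i + 1))) (h₄ : ∀ i, β i → β (i + 2) → (N i ↔ N (i + 2)))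
    (h₅ : ∀ i, β i → β (i + 1) → N i ∨ N (i + 1)) :
    (∃ r, ¬ β (4 + r) ∧ (¬ β (2 + r) ∨ ¬ β (3 + r)) ∧ ¬ α (0 + r) ∧ ¬ α (3 + r)) ∨
      ((∀ i, ¬ α i) ∧ ∀ i j, i ≠ j → β i ∨ β j) := by
  rw [or_iff_not_imp_left]
  intro h
  push Not at h
  obtain ⟨s, hs⟩ := hN
  have hs : N 0 ∨ N 1 ∨ N 2 ∨ N 3 ∨ N 4 := by
    rcases IsFrame.fin_five_cases s with rfl | rfl | rfl | rfl | rfl <;> simp [hs]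
  simp only [forall_fin_five, Fin.reduceAdd] at *
  by_cases h0 : β 0 <;> by_cases h1 : β 1 <;> by_cases h2 : β 2 <;> by_cases h3 : β 3 <;>
    by_cases h4 : β 4 <;> simp [h0, h1, h2, h3, h4] at h h₁ h₄ h₅ hβ ⊢ <;> grind

theorem forall_of_forall_ne (β N U : Fin 5 → Prop) (hβ : ∀ i j, i ≠ j → β i ∨ β j)
    (hN : ∃ i, N i) (hNβ : ∀ i, N i → β i) (h₂ : ∀ i, N i → β (i + 2) → U (i + 2))
    (h₃ : ∀ i, N i → β (i + 3) → U (i + 3)) (hUN : ∀ i, U i → β i → N i)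
    (hU : ∀ i, ¬ β i → U i) : ∀ i, U i := by
  obtain ⟨s, hs⟩ := hN
  have hs : N 0 ∨ N 1 ∨ N 2 ∨ N 3 ∨ N 4 := by
    rcases IsFrame.fin_five_cases s with rfl | rfl | rfl | rfl | rfl <;> simp [hs]
  simp only [forall_fin_five, Fin.reduceAdd] at *
  by_cases h0 : β 0 <;> by_cases h1 : β 1 <;> by_cases h2 : β 2 <;> by_cases h3 : β 3 <;>
    by_cases h4 : β 4 <;> simp [h0, h1, h2, h3, h4] at hβ hNβ h₂ h₃ hUN hU ⊢ <;> grind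

namespace IsFrame

variable {V : Type*} {G : SimpleGraph V} {c : V} {v : Fin 5 → V}

theorem not_a_a (F : P5W4Free G) (h : IsFrame G c v) (i : Fin 5) :
    ¬ ((part G c v (a i)).Nonempty ∧ (part G c v (a (i + 1))).Nonempty) := by
  rintro ⟨⟨p, hp⟩, q, hq⟩
  simp only [part, add_assoc, Fin.reduceAdd, add_zero, Set.mem_ofPred_eq] at hp hq
  exact (h i).a_a_one F hp hq

theorem ncard_part_x_pos [Finite V] (h : IsFrame G c v) (i : Fin 5) :
    0 < (part G c v (x i)).ncard :=
  (Set.ncard_pos (Set.toFinite _)).2 ⟨v i, h.rim_mem i⟩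

theorem t_b_iff (F : P5W4Free G) (h : IsFrame G c v) {i : Fin 5} {s p q : V}
    (hs : s ∈ part G c v t) (hp : p ∈ part G c v (b i)) (hq : q ∈ part G c v (b (i + 2))) :
    G.Adj s p ↔ G.Adj s q := by
  simp only [part, add_assoc, Fin.reduceAdd, add_zero, Set.mem_ofPred_eq] at hp hq
  exact (h i).t_b_iff_b_two F hp hq (isT_of_mem hs i)

theorem isNice_of_t_empty [Finite V] (F : P5W4Free G) (h : IsFrame G c v) (hconn : G.Connected)
    (hatom : IsGraphAtom G) (ht : ¬ (part G c v t).Nonempty) : IsNice G := by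
  by_cases hb : ∃ j, ¬ (part G c v (b j)).Nonempty
  · obtain ⟨j, hj⟩ := hb
    refine (h.isDecomp_rotate F hconn hatom (j + 1)).isNice_of_t_empty ?_ ?_
    · rwa [part_rotate_t]
    · rw [part_rotate_b, add_left_comm, show (4 : Fin 5) + 1 = 0 from rfl, add_zero]
      exact fun e => (hj e).elim
  · obtain ⟨j, hj, hn⟩ := exists_lt_add_of_not_consecutive _ h.ncard_part_x_pos _ (h.not_a_a F)
    refine (h.isDecomp_rotate F hconn hatom (j + 1)).isNice_of_t_empty ?_ ?_
    · rwa [part_rotate_t]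
    · simp only [part_rotate_a, part_rotate_x]
      simpa only [add_left_comm _ j, Fin.reduceAdd, add_zero] using fun _ => ⟨hj, hn⟩

theorem isNice_of_t_nonempty [Finite V] (F : P5W4Free G) (h : IsFrame G c v) (hconn : G.Connected)
    (hatom : IsGraphAtom G) (ht : (part G c v t).Nonempty) : IsNice G := by
  have hT := h.exists_adj_b F hconn hatom
  have htc : ∀ s ∈ part G c v t, G.Adj s c := by
    intro s hs
    obtain ⟨i, w, hw, hsw⟩ := hT s hs
    exact (h i).t_hub F hw (isT_of_mem hs i) (isZ_of_mem h.hub_mem i) hsw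
  obtain ⟨s, hs⟩ := ht
  rcases exists_not_or_forall_ne (fun i => (part G c v (a i)).Nonempty)
    (fun i => (part G c v (b i)).Nonempty) (fun i => ∃ w ∈ part G c v (b i), G.Adj s w)
    (fun i ⟨w, hw, _⟩ => ⟨w, hw⟩) (hT s hs)
    (fun i ⟨p, hp⟩ ⟨w, hw⟩ => ⟨w, hw, (h i).t_b_of_a F hp hw (isT_of_mem hs i) (htc s hs)⟩)
    (fun i ⟨p, hp⟩ ⟨w, hw, hsw⟩ => (h i).t_b_of_a_two F hp
      (by simpa [part, add_assoc] using hw) (isT_of_mem hs i) hsw)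
    (fun i ⟨p, hp⟩ ⟨w, hw, hsw⟩ => (h i).t_b_of_a_three F hp
      (by simpa [part, add_assoc] using hw) (isT_of_mem hs i) hsw)
    (h.not_a_a F)
    (fun i ⟨p, hp⟩ ⟨q, hq⟩ => ⟨fun ⟨w, hw, hsw⟩ => ⟨q, hq, (h.t_b_iff F hs hw hq).1 hsw⟩,
      fun ⟨w, hw, hsw⟩ => ⟨p, hp, (h.t_b_iff F hs hp hw).2 hsw⟩⟩)
    (fun i ⟨p, hp⟩ ⟨q, hq⟩ => ((h i).t_b_or_b_one F hp (by simpa [part, add_assoc] using hq)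
      (isT_of_mem hs i) (htc s hs)).imp (fun e => ⟨p, hp, e⟩) fun e => ⟨q, hq, e⟩)
    with ⟨r, h4, h23, ha0, ha3⟩ | ⟨ha, hb⟩
  · apply (h.isDecomp_rotate F hconn hatom r).isNice_of_b_empty <;>
      simpa only [part_rotate_a, part_rotate_b]
  · have hU : ∀ u ∈ part G c v t, ∀ i, ∀ w ∈ part G c v (b i), G.Adj u w := by
      intro u hu
      refine forall_of_forall_ne (fun i => (part G c v (b i)).Nonempty)
        (fun i => ∃ w ∈ part G c v (b i), G.Adj u w) (fun i => ∀ w ∈ part G c v (b i), G.Adj u w)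
        hb (hT u hu) (fun i ⟨w, hw, _⟩ => ⟨w, hw⟩)
        (fun i ⟨p, hp, hup⟩ _ q hq => (h.t_b_iff F hu hp hq).1 hup)
        (fun i ⟨p, hp, hup⟩ _ q hq => ?_) (fun i e ⟨w, hw⟩ => ⟨w, hw, e w hw⟩)
        (fun i e w hw => (e ⟨w, hw⟩).elim)
      refine (h.t_b_iff F hu hq ?_).2 hup
      rwa [add_assoc, show (3 : Fin 5) + 2 = 0 from rfl, add_zero]
    obtain ⟨r, h1, h2, h3⟩ := exists_lt_add_three _ h.ncard_part_x_pos
    refine (h.isDecomp_rotate F hconn hatom r).isNice_of_t_b_complete ?_ ?_ ?_ ?_ ?_ ?_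
    · exact fun i => part_rotate_a (v := v) r i ▸ ha _
    · intro i u hu w hw
      rw [part_rotate_t] at hu
      rw [part_rotate_b] at hw
      exact hU u hu _ w hw
    · simp only [part_rotate_b]
      exact hb _ _ fun e => absurd (add_right_cancel e) (by decide)
    all_goals simpa only [part_rotate_x]

end IsFrame

theorem stmt_3 {V : Type*} [Fintype V] (G : SimpleGraph V)
    (hconn : G.Connected)
    (hP5 : InducedFree (SimpleGraph.pathGraph 5) G)
    (hW4 : InducedFree (wheel 4) G)
    (hatom : IsGraphAtom G)
    (h5W : Nonempty (wheel 5 ↪g G)) :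
    IsNice G := by
  have F := P5W4Free.of_inducedFree hP5 hW4
  obtain ⟨c, v, h⟩ := exists_isFrame h5W
  by_cases ht : (part G c v t).Nonempty
  · exact h.isNice_of_t_nonempty F hconn hatom ht
  · exact h.isNice_of_t_empty F hconn hatom ht
end

section
/- If G is a connected (P_5, C_5, 4-wheel)-free graph that contains an induced complement of C_7, then G is a blowup of the graph H*, and consequently G is a nice graph. -/
open SimpleGraph

/-- The edge relation of the graph `H*`: the complement of `C₇` on
`v₁, …, v₇` (here `0, …, 6`) together with `v₈ = 7` adjacent to `v₁, v₂, v₅`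
and `v₉ = 8` adjacent to `v₂, v₅, v₆`. -/
def hstarRel : Fin 9 → Fin 9 → Prop := fun x y =>
  ((x : ℕ), (y : ℕ)) ∈ [(0, 1), (1, 2), (2, 3), (3, 4), (4, 5), (5, 6), (6, 0),
    (0, 2), (1, 3), (2, 4), (3, 5), (4, 6), (5, 0), (6, 1),
    (7, 0), (7, 1), (7, 4), (8, 1), (8, 4), (8, 5)]

/-- The graph `H*`. -/
def Hstar : SimpleGraph (Fin 9) := SimpleGraph.fromRel hstarRel

/-- `G` is a blowup of `H`: `V(G)` is partitioned into sets `Q w`, `w ∈ V(H)`,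
each inducing a `P₃`-free graph, with `Q w₁` complete to `Q w₂` when
`w₁w₂ ∈ E(H)` and anticomplete when `w₁w₂ ∉ E(H)`. -/
def IsBlowup {V W : Type*} (G : SimpleGraph V) (H : SimpleGraph W) : Prop :=
  ∃ Q : W → Set V,
    (∀ v : V, ∃! w : W, v ∈ Q w) ∧
    (∀ w : W, InducedFree (SimpleGraph.pathGraph 3) (G.induce (Q w))) ∧
    (∀ w₁ w₂ : W, H.Adj w₁ w₂ → ∀ a ∈ Q w₁, ∀ b ∈ Q w₂, G.Adj a b) ∧
    (∀ w₁ w₂ : W, w₁ ≠ w₂ → ¬ H.Adj w₁ w₂ → ∀ a ∈ Q w₁, ∀ b ∈ Q w₂, ¬ G.Adj a b)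

/-- A map realizing the adjacency of `H` injectively contradicts `InducedFree H G`. -/
theorem InducedFree.false_of_map {W V : Type*} {H : SimpleGraph W} {G : SimpleGraph V}
    (h : InducedFree H G) (f : W → V) (hf : Function.Injective f)
    (hadj : ∀ i j, G.Adj (f i) (f j) ↔ H.Adj i j) : False :=
  h.false ⟨⟨f, hf⟩, fun {i j} => hadj i j⟩

/-- A map realizing the adjacency of a graph without twins contradicts `InducedFree`. -/
theorem InducedFree.false_of_map_of_twinFree {W V : Type*} {H : SimpleGraph W}
    {G : SimpleGraph V} (h : InducedFree H G) (htwin : ∀ i j, (∀ k, H.Adj i k ↔ H.Adj j k) → i = j)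
    (f : W → V) (hadj : ∀ i j, G.Adj (f i) (f j) ↔ H.Adj i j) : False :=
  h.false_of_map f (fun i j hij => htwin i j fun k => by rw [← hadj, ← hadj, hij]) hadj

theorem inducedFree_pathGraph_three_iff {V : Type*} {G : SimpleGraph V} :
    InducedFree (pathGraph 3) G ↔
      ∀ a b c, G.Adj a b → G.Adj b c → a ≠ c → G.Adj a c := by
  constructor
  · intro h a b c hab hbc hac
    by_contra hn
    refine h.false_of_map ![a, b, c] ?_ ?_
    · intro i j
      have := hab.ne
      have := hbc.ne
      fin_cases i <;> fin_cases j <;> simp_all [eq_comm]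
    · intro i j
      fin_cases i <;> fin_cases j <;> simp_all [pathGraph_adj, G.adj_comm]
  · intro h
    refine ⟨fun e => ?_⟩
    have h01 : G.Adj (e 0) (e 1) := by simp [pathGraph_adj]
    have h12 : G.Adj (e 1) (e 2) := by simp [pathGraph_adj]
    have h02 : ¬ G.Adj (e 0) (e 2) := by simp [pathGraph_adj]
    exact h02 (h _ _ _ h01 h12 (by simp))

section Forbidden

variable {V : Type*} {G : SimpleGraph V}

theorem false_of_induced_path_or_cycle (hP5 : InducedFree (pathGraph 5) G)
    (hC5 : InducedFree (cycleGraph 5) G) {a b c d e : V}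
    (hab : G.Adj a b) (hbc : G.Adj b c) (hcd : G.Adj c d) (hde : G.Adj d e)
    (hac : ¬ G.Adj a c) (had : ¬ G.Adj a d) (hbd : ¬ G.Adj b d) (hbe : ¬ G.Adj b e)
    (hce : ¬ G.Adj c e) : False := by
  by_cases hae : G.Adj a e
  · refine hC5.false_of_map_of_twinFree (by decide +kernel) ![a, b, c, d, e] fun i j => ?_
    have key : ∀ i j : Fin 5, (cycleGraph 5).Adj i j ↔ j = i + 1 ∨ i = j + 1 := by decide +kernel
    rw [key]
    fin_cases i <;> fin_cases j <;> simp_all [G.adj_comm]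
  · refine hP5.false_of_map_of_twinFree ?_ ![a, b, c, d, e] fun i j => ?_
    · simp only [pathGraph_adj]
      decide +kernel
    · fin_cases i <;> fin_cases j <;> simp_all [pathGraph_adj, G.adj_comm]

theorem false_of_wheel (hW4 : InducedFree (wheel 4) G) {a b c d e : V}
    (hab : G.Adj a b) (hbc : G.Adj b c) (hcd : G.Adj c d) (hda : G.Adj a d)
    (hac : ¬ G.Adj a c) (hbd : ¬ G.Adj b d) (hac' : a ≠ c) (hbd' : b ≠ d)
    (hea : G.Adj e a) (heb : G.Adj e b) (hec : G.Adj e c) (hed : G.Adj e d) : False := by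
  have key : ∀ i j : Fin 4, (cycleGraph 4).Adj i j ↔ j = i + 1 ∨ i = j + 1 := by decide +kernel
  have := hab.ne
  have := hbc.ne
  have := hcd.ne
  have := hda.ne
  refine hW4.false_of_map (Sum.elim ![a, b, c, d] fun _ => e) ?_ ?_
  · refine Function.Injective.sumElim ?_ (fun _ _ _ => rfl) ?_
    · intro i j
      fin_cases i <;> fin_cases j <;> simp_all [eq_comm]
    · intro i _
      fin_cases i
      exacts [hea.ne', heb.ne', hec.ne', hed.ne']
  · rintro (i | i) (j | j)
    · simp only [wheel, fromRel_adj, Sum.elim_inl, key]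
      fin_cases i <;> fin_cases j <;> simp_all [G.adj_comm]
    · fin_cases i <;> simp_all [wheel, G.adj_comm]
    · fin_cases j <;> simp_all [wheel]
    · simp [wheel]

end Forbidden

/-- The Boolean adjacency matrix `m` exhibits an induced `P₅`, `C₅` or 4-wheel whose
nonadjacent rim vertices are told apart by some row of `m`. -/
def HasForbidden {n : ℕ} (m : Fin n → Fin n → Bool) : Prop :=
  ∃ a b, m a b = true ∧ ∃ c, m b c = true ∧ m a c = false ∧ ∃ d, m c d = true ∧ m b d = false ∧
    ((m a d = false ∧ ∃ e, m d e = true ∧ m b e = false ∧ m c e = false) ∨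
     (m a d = true ∧ (∃ x, m x a ≠ m x c) ∧ (∃ x, m x b ≠ m x d) ∧
      ∃ e, m e a = true ∧ m e b = true ∧ m e c = true ∧ m e d = true))

instance {n : ℕ} (m : Fin n → Fin n → Bool) : Decidable (HasForbidden m) := by
  unfold HasForbidden
  infer_instance

/-- `m` is the adjacency matrix of the family `f` of vertices of `G`. -/
def IsAdjMatrixOf {V : Type*} {n : ℕ} (G : SimpleGraph V) (m : Fin n → Fin n → Bool)
    (f : Fin n → V) : Prop :=
  ∀ i j, G.Adj (f i) (f j) ↔ m i j = true

/-- The adjacency matrix obtained by adding a new first vertex with adjacency vector `s`. -/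
def extendMatrix {n : ℕ} (m : Fin n → Fin n → Bool) (s : Fin n → Bool) :
    Fin (n + 1) → Fin (n + 1) → Bool :=
  Fin.cons (Fin.cons false s) fun i => Fin.cons (s i) (m i)

section Matrix

variable {V : Type*} {G : SimpleGraph V} {n : ℕ} {m : Fin n → Fin n → Bool} {f : Fin n → V}

theorem IsAdjMatrixOf.extend (h : IsAdjMatrixOf G m f) {v : V} {s : Fin n → Bool}
    (hs : ∀ i, G.Adj v (f i) ↔ s i = true) :
    IsAdjMatrixOf G (extendMatrix m s) (Fin.cons v f : Fin (n + 1) → V) := by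
  intro i j
  refine Fin.cases ?_ (fun i => ?_) i <;> refine Fin.cases ?_ (fun j => ?_) j
  · simp [extendMatrix]
  · simpa [extendMatrix] using hs j
  · simpa [extendMatrix, G.adj_comm] using hs i
  · simpa [extendMatrix] using h i j

theorem IsAdjMatrixOf.not_hasForbidden (h : IsAdjMatrixOf G m f)
    (hP5 : InducedFree (pathGraph 5) G) (hC5 : InducedFree (cycleGraph 5) G)
    (hW4 : InducedFree (wheel 4) G) : ¬ HasForbidden m := by
  have hF : ∀ {i j}, m i j = false → ¬ G.Adj (f i) (f j) := fun {i j} hij => by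
    simp [h i j, hij]
  have hT : ∀ {i j}, m i j = true → G.Adj (f i) (f j) := fun {i j} hij => (h i j).2 hij
  have hne : ∀ {i j}, (∃ x, m x i ≠ m x j) → f i ≠ f j := by
    rintro i j ⟨x, hx⟩ hij
    exact hx (Bool.eq_iff_iff.2 (by rw [← h, ← h, hij]))
  rintro ⟨a, b, hab, c, hbc, hac, d, hcd, hbd, ⟨had, e, hde, hbe, hce⟩ |
    ⟨had, hx, hy, e, hea, heb, hec, hed⟩⟩
  · exact false_of_induced_path_or_cycle hP5 hC5 (hT hab) (hT hbc) (hT hcd) (hT hde) (hF hac)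
      (hF had) (hF hbd) (hF hbe) (hF hce)
  · exact false_of_wheel hW4 (hT hab) (hT hbc) (hT hcd) (hT had) (hF hac) (hF hbd) (hne hx)
      (hne hy) (hT hea) (hT heb) (hT hec) (hT hed)

end Matrix

/-- Adjacency of the complement of `C₇`, with `i` adjacent to `i ± 1` and `i ± 2`. -/
def coC7 (i j : Fin 7) : Bool := j - i = 1 || j - i = 2 || j - i = 5 || j - i = 6

/-- The graph on the vertices of the complement of `C₇` (left) together with, for each `i`, a vertex
(right) adjacent exactly to `i`, `i + 1` and `i + 4`. It contains every way in which a vertex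
can attach to an induced complement of `C₇`. -/
def attachAdj : Fin 7 ⊕ Fin 7 → Fin 7 ⊕ Fin 7 → Bool
  | .inl i, .inl j => coC7 i j
  | .inl i, .inr j => i - j = 0 || i - j = 1 || i - j = 4
  | .inr i, .inl j => j - i = 0 || j - i = 1 || j - i = 4
  | .inr _, .inr _ => false

/-- The adjacency vector towards the complement of `C₇` of a vertex attaching like `k`, where `p`
tells whether it is adjacent to its twin. -/
def attachVec (p : Bool) (k : Fin 7 ⊕ Fin 7) (j : Fin 7) : Bool :=
  if .inl j = k then p else attachAdj k (.inl j)

theorem attach_classification : ∀ b₀ b₁ b₂ b₃ b₄ b₅ b₆ : Bool,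
    (∀ j, ![b₀, b₁, b₂, b₃, b₄, b₅, b₆] j = false) ∨
    (∃ k : Fin 7 ⊕ Fin 7, ∀ j, .inl j ≠ k →
      ![b₀, b₁, b₂, b₃, b₄, b₅, b₆] j = attachAdj k (.inl j)) ∨
    HasForbidden (extendMatrix coC7 ![b₀, b₁, b₂, b₃, b₄, b₅, b₆]) := by
  decide +kernel

/-- The rotation by `r` of the attachment types. -/
def rotate (r : Fin 7) : Fin 7 ⊕ Fin 7 → Fin 7 ⊕ Fin 7 := Sum.map (· + r) (· + r)

theorem coC7_rotate (i j r : Fin 7) : coC7 (i + r) (j + r) = coC7 i j := by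
  simp [coC7]

theorem attachAdj_rotate (r : Fin 7) (k l : Fin 7 ⊕ Fin 7) :
    attachAdj (rotate r k) (rotate r l) = attachAdj k l := by
  rcases k with k | k <;> rcases l with l | l <;> simp [attachAdj, coC7, rotate]

theorem rotate_neg_rotate (r : Fin 7) (k : Fin 7 ⊕ Fin 7) : rotate r (rotate (-r) k) = k := by
  rcases k with k | k <;> simp [rotate]

theorem exists_eq_rotate (k : Fin 7 ⊕ Fin 7) :
    ∃ r k', (k' = .inl 0 ∨ k' = .inr 0) ∧ k = rotate r k' := by
  rcases k with k | k
  · exact ⟨k, _, .inl rfl, by simp [rotate]⟩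
  · exact ⟨k, _, .inr rfl, by simp [rotate]⟩

theorem hasForbidden_of_wrong_adj : ∀ k : Fin 7 ⊕ Fin 7, k = .inl 0 ∨ k = .inr 0 →
    ∀ (l : Fin 7 ⊕ Fin 7) (p q : Bool), k ≠ l →
    HasForbidden (extendMatrix (extendMatrix coC7 (attachVec q l))
      (Fin.cons (!attachAdj k l) (attachVec p k) : Fin 8 → Bool)) := by
  decide +kernel

theorem hasForbidden_of_inr_inr : ∀ j : Fin 7, j ≠ 0 → j ≠ 3 → j ≠ 4 →
    HasForbidden (extendMatrix (extendMatrix coC7 (attachVec false (.inr j)))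
      (Fin.cons false (attachVec false (.inr 0)) : Fin 8 → Bool)) := by
  decide +kernel

theorem hasForbidden_of_adj_anticomplete : ∀ k : Fin 7 ⊕ Fin 7, k = .inl 0 ∨ k = .inr 0 →
    ∀ p : Bool, HasForbidden (extendMatrix (extendMatrix coC7 fun _ => false)
      (Fin.cons true (attachVec p k) : Fin 8 → Bool)) := by
  decide +kernel

theorem attachAdj_injective : ∀ k l : Fin 7 ⊕ Fin 7,
    (∀ j, .inl j ≠ k → .inl j ≠ l → attachAdj k (.inl j) = attachAdj l (.inl j)) → k = l := by
  decide +kernel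

theorem exists_nonadj_neighbors : ∀ k : Fin 7 ⊕ Fin 7, ∃ i j : Fin 7, i ≠ j ∧ coC7 i j = false ∧
    .inl i ≠ k ∧ .inl j ≠ k ∧ attachAdj k (.inl i) = true ∧ attachAdj k (.inl j) = true := by
  decide +kernel

/-- Attachment types of the vertices of `H*`. -/
def hstarType : Fin 9 → Fin 7 ⊕ Fin 7 :=
  ![.inl 0, .inl 1, .inl 2, .inl 3, .inl 4, .inl 5, .inl 6, .inr 0, .inr 4]

instance : DecidableRel Hstar.Adj := fun x y => by
  unfold Hstar hstarRel
  infer_instance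

theorem hstar_adj_iff : ∀ i j : Fin 9,
    Hstar.Adj i j ↔ attachAdj (hstarType i) (hstarType j) = true := by
  decide +kernel

theorem hstarType_injective : ∀ i j : Fin 9, hstarType i = hstarType j → i = j := by
  decide +kernel

theorem exists_hstarType_eq : ∀ k : Fin 7 ⊕ Fin 7,
    (∀ j : Fin 7, k = .inr j → j = 0 ∨ j = 4) → ∃ i, hstarType i = k := by
  decide +kernel

section Attach

variable {V : Type*} {G : SimpleGraph V} {w : Fin 7 → V}

/-- `v` attaches to the vertices `w` other than its possible twin in the way `k` does. -/
def AttachesLike (G : SimpleGraph V) (w : Fin 7 → V) (k : Fin 7 ⊕ Fin 7) (v : V) : Prop :=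
  ∀ j, .inl j ≠ k → (G.Adj v (w j) ↔ attachAdj k (.inl j) = true)

theorem AttachesLike.exists_attachVec {k : Fin 7 ⊕ Fin 7} {v : V} (h : AttachesLike G w k v) :
    ∃ p, ∀ j, G.Adj v (w j) ↔ attachVec p k j = true := by
  classical
  rcases k with i | i
  · refine ⟨decide (G.Adj v (w i)), fun j => ?_⟩
    by_cases hj : (Sum.inl j : Fin 7 ⊕ Fin 7) = .inl i
    · obtain rfl := Sum.inl.inj hj
      simp [attachVec]
    · simpa [attachVec, hj] using h j hj
  · exact ⟨false, fun j => by simpa [attachVec] using h j (by simp)⟩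

theorem attachesLike_self (hw : IsAdjMatrixOf G coC7 w) (i : Fin 7) :
    AttachesLike G w (.inl i) (w i) :=
  fun j _ => hw i j

theorem AttachesLike.eq {k l : Fin 7 ⊕ Fin 7} {v : V} (hk : AttachesLike G w k v)
    (hl : AttachesLike G w l v) : k = l :=
  attachAdj_injective k l fun j hjk hjl =>
    Bool.eq_iff_iff.2 ((hk j hjk).symm.trans (hl j hjl))

theorem IsAdjMatrixOf.rotate (hw : IsAdjMatrixOf G coC7 w) (r : Fin 7) :
    IsAdjMatrixOf G coC7 fun i => w (i + r) :=
  fun i j => by rw [hw, coC7_rotate]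

theorem attachesLike_rotate_iff {r : Fin 7} {k : Fin 7 ⊕ Fin 7} {v : V} :
    AttachesLike G w (rotate r k) v ↔ AttachesLike G (fun i => w (i + r)) k v := by
  have hinl : ∀ j, (.inl (j + r) : Fin 7 ⊕ Fin 7) = _root_.rotate r (.inl j) := fun j => rfl
  have hinj : ∀ j, (.inl (j + r) : Fin 7 ⊕ Fin 7) = _root_.rotate r k ↔ .inl j = k := by
    intro j
    rcases k with k | k <;> simp [_root_.rotate]
  constructor
  · intro h j hj
    rw [h (j + r) (by rwa [Ne, hinj]), hinl, attachAdj_rotate]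
  · intro h j hj
    have := h (j - r) (by rwa [Ne, ← hinj, sub_add_cancel])
    rw [← attachAdj_rotate r, ← hinl] at this
    simpa using this

theorem attachesLike_or_anticomplete
    (hP5 : InducedFree (pathGraph 5) G) (hC5 : InducedFree (cycleGraph 5) G)
    (hW4 : InducedFree (wheel 4) G) (hw : IsAdjMatrixOf G coC7 w)
    (v : V) :
    (∃ k, AttachesLike G w k v) ∨ ∀ j, ¬ G.Adj v (w j) := by
  classical
  have hvec : ![decide (G.Adj v (w 0)), decide (G.Adj v (w 1)), decide (G.Adj v (w 2)),
      decide (G.Adj v (w 3)), decide (G.Adj v (w 4)), decide (G.Adj v (w 5)),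
      decide (G.Adj v (w 6))] = fun j => decide (G.Adj v (w j)) := by
    funext j
    fin_cases j <;> rfl
  have := attach_classification (decide (G.Adj v (w 0))) (decide (G.Adj v (w 1)))
    (decide (G.Adj v (w 2))) (decide (G.Adj v (w 3))) (decide (G.Adj v (w 4)))
    (decide (G.Adj v (w 5))) (decide (G.Adj v (w 6)))
  rw [hvec] at this
  rcases this with h | ⟨k, hk⟩ | h
  · exact .inr fun j => by simpa using h j
  · exact .inl ⟨k, fun j hj => by simp [← hk j hj]⟩
  · exact absurd h ((hw.extend (v := v) fun i => by simp).not_hasForbidden hP5 hC5 hW4)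

theorem AttachesLike.adj_iff
    (hP5 : InducedFree (pathGraph 5) G) (hC5 : InducedFree (cycleGraph 5) G)
    (hW4 : InducedFree (wheel 4) G) (hw : IsAdjMatrixOf G coC7 w)
    {k l : Fin 7 ⊕ Fin 7} {u v : V} (hu : AttachesLike G w k u)
    (hv : AttachesLike G w l v) (hkl : k ≠ l) : G.Adj u v ↔ attachAdj k l = true := by
  obtain ⟨r, k, hk, rfl⟩ := exists_eq_rotate k
  rw [← rotate_neg_rotate r l] at hv hkl ⊢
  rw [attachAdj_rotate]
  replace hkl : k ≠ _root_.rotate (-r) l := fun h => hkl (congrArg _ h)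
  obtain ⟨p, hp⟩ := (attachesLike_rotate_iff.1 hu).exists_attachVec
  obtain ⟨q, hq⟩ := (attachesLike_rotate_iff.1 hv).exists_attachVec
  by_contra hne
  refine (((hw.rotate r).extend hq).extend (v := u) (s := Fin.cons _ _) fun i => ?_).not_hasForbidden
    hP5 hC5 hW4 (hasForbidden_of_wrong_adj k hk _ p q hkl)
  refine Fin.cases ?_ (fun j => ?_) i
  · simp only [Fin.cons_zero]
    cases h : attachAdj k (_root_.rotate (-r) l) <;> simp_all
  · simpa using hp j

theorem AttachesLike.not_adj_of_anticomplete
    (hP5 : InducedFree (pathGraph 5) G) (hC5 : InducedFree (cycleGraph 5) G)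
    (hW4 : InducedFree (wheel 4) G) (hw : IsAdjMatrixOf G coC7 w)
    {k : Fin 7 ⊕ Fin 7} {u v : V}
    (hu : AttachesLike G w k u) (hv : ∀ j, ¬ G.Adj v (w j)) : ¬ G.Adj u v := by
  obtain ⟨r, k, hk, rfl⟩ := exists_eq_rotate k
  obtain ⟨p, hp⟩ := (attachesLike_rotate_iff.1 hu).exists_attachVec
  intro huv
  refine (((hw.rotate r).extend (v := v) (s := fun _ => false) fun i => ?_).extend (v := u)
    (s := Fin.cons _ _) fun i => ?_).not_hasForbidden
    hP5 hC5 hW4 (hasForbidden_of_adj_anticomplete k hk p)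
  · simpa using hv (i + r)
  · refine Fin.cases ?_ (fun j => ?_) i
    · simpa using huv
    · simpa using hp j

theorem AttachesLike.eq_or_eq_of_inr
    (hP5 : InducedFree (pathGraph 5) G) (hC5 : InducedFree (cycleGraph 5) G)
    (hW4 : InducedFree (wheel 4) G) (hw : IsAdjMatrixOf G coC7 w)
    {i j : Fin 7} {u v : V} (hu : AttachesLike G w (.inr i) u)
    (hv : AttachesLike G w (.inr j) v) : j = i ∨ j = i + 3 ∨ j = i + 4 := by
  by_contra! hj
  have hnadj : ¬ G.Adj u v := by
    rw [hu.adj_iff hP5 hC5 hW4 hw hv (by simpa using hj.1.symm)]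
    simp [attachAdj]
  have hi' : (.inr i : Fin 7 ⊕ Fin 7) = rotate i (.inr 0) := by simp [rotate]
  have hj' : (.inr j : Fin 7 ⊕ Fin 7) = rotate i (.inr (j - i)) := by simp [rotate]
  rw [hi', attachesLike_rotate_iff] at hu
  rw [hj', attachesLike_rotate_iff] at hv
  refine (((hw.rotate i).extend (v := v) (s := attachVec false (.inr (j - i))) fun k => ?_).extend
    (v := u) (s := Fin.cons _ _) fun k => ?_).not_hasForbidden hP5 hC5 hW4
    (hasForbidden_of_inr_inr (j - i) ?_ ?_ ?_)
  · simpa [attachVec] using hv k (by simp)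
  · refine Fin.cases ?_ (fun k => ?_) k
    · simpa using hnadj
    · simpa [attachVec] using hu k (by simp)
  · exact fun h => hj.1 (sub_eq_zero.1 h)
  · exact fun h => hj.2.1 (by rw [← h]; abel)
  · exact fun h => hj.2.2 (by rw [← h]; abel)

theorem AttachesLike.adj_trans
    (hW4 : InducedFree (wheel 4) G) (hw : IsAdjMatrixOf G coC7 w)
    {k : Fin 7 ⊕ Fin 7} {a b c : V} (ha : AttachesLike G w k a)
    (hb : AttachesLike G w k b) (hc : AttachesLike G w k c) (hab : G.Adj a b) (hbc : G.Adj b c)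
    (hac : a ≠ c) : G.Adj a c := by
  by_contra hn
  obtain ⟨i, j, hij, hcij, hi, hj, hki, hkj⟩ := exists_nonadj_neighbors k
  have hadj : ∀ {x}, AttachesLike G w k x → G.Adj x (w i) ∧ G.Adj x (w j) := fun hx =>
    ⟨(hx i hi).2 hki, (hx j hj).2 hkj⟩
  have hwij : w i ≠ w j := fun h => hij (Sum.inl.inj
    ((attachesLike_self hw i).eq (h ▸ attachesLike_self hw j)))
  refine false_of_wheel hW4 (hadj ha).1 (hadj hc).1.symm (hadj hc).2 (hadj ha).2 hn ?_ hac hwij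
    hab.symm (hadj hb).1 hbc (hadj hb).2
  rw [hw i j, hcij]
  simp

theorem exists_rotate_inr_eq
    (hP5 : InducedFree (pathGraph 5) G) (hC5 : InducedFree (cycleGraph 5) G)
    (hW4 : InducedFree (wheel 4) G) (hw : IsAdjMatrixOf G coC7 w) : ∃ r : Fin 7, ∀ (v : V) (j : Fin 7),
    AttachesLike G (fun i => w (i + r)) (.inr j) v → j = 0 ∨ j = 4 := by
  by_cases h : ∃ i v, AttachesLike G w (.inr i) v
  · obtain ⟨i, v, hv⟩ := h
    have hinr : ∀ r j : Fin 7, (.inr (j + r) : Fin 7 ⊕ Fin 7) = rotate r (.inr j) :=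
      fun _ _ => rfl
    by_cases h3 : ∃ u, AttachesLike G w (.inr (i + 3)) u
    · obtain ⟨u, hu⟩ := h3
      refine ⟨i + 3, fun x j hx => ?_⟩
      rw [← attachesLike_rotate_iff, ← hinr] at hx
      have h1 := hv.eq_or_eq_of_inr hP5 hC5 hW4 hw hx
      have h2 := hu.eq_or_eq_of_inr hP5 hC5 hW4 hw hx
      clear * - h1 h2
      revert i j
      decide +kernel
    · refine ⟨i, fun x j hx => ?_⟩
      rw [← attachesLike_rotate_iff, ← hinr] at hx
      have h1 := hv.eq_or_eq_of_inr hP5 hC5 hW4 hw hx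
      have h2 : j + i ≠ i + 3 := fun h => h3 ⟨x, h ▸ hx⟩
      clear * - h1 h2
      revert i j
      decide +kernel
  · exact ⟨0, fun v j hv => absurd ⟨j, v, by simpa using hv⟩ h⟩

theorem exists_attachesLike
    (hP5 : InducedFree (pathGraph 5) G) (hC5 : InducedFree (cycleGraph 5) G)
    (hW4 : InducedFree (wheel 4) G) (hw : IsAdjMatrixOf G coC7 w)
    (hconn : G.Connected) (v : V) : ∃ k, AttachesLike G w k v := by
  have hstep : ∀ {a b}, G.Walk a b → (∃ k, AttachesLike G w k a) → ∃ k, AttachesLike G w k b := by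
    intro a b p
    induction p with
    | nil => exact id
    | cons hab _ ih =>
      rintro ⟨k, hk⟩
      exact ih ((attachesLike_or_anticomplete hP5 hC5 hW4 hw _).resolve_right fun h =>
        hk.not_adj_of_anticomplete hP5 hC5 hW4 hw h hab)
  obtain ⟨p⟩ := hconn.preconnected (w 0) v
  exact hstep p ⟨_, attachesLike_self hw 0⟩

end Attach

section Nice

variable {V : Type*} {G : SimpleGraph V}

theorem exists_maximal_stable [Finite V] (G : SimpleGraph V) (Q : Set V) :
    ∃ T ⊆ Q, IsStableSet G T ∧ ∀ v ∈ Q, v ∉ T → ∃ t ∈ T, G.Adj v t := by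
  obtain ⟨T, hT⟩ := (Set.toFinite {T : Set V | T ⊆ Q ∧ IsStableSet G T}).exists_maximal
    ⟨∅, Set.empty_subset _, Set.pairwise_empty _⟩
  refine ⟨T, hT.prop.1, hT.prop.2, fun v hv hvT => ?_⟩
  by_contra! hn
  refine hvT (hT.le_of_ge (y := insert v T) ⟨Set.insert_subset hv hT.prop.1, ?_⟩
    (Set.subset_insert v T) (Set.mem_insert v T))
  exact hT.prop.2.insert fun t ht _ => ⟨hn t ht, fun h => hn t ht h.symm⟩

theorem hstar_clique_extension : ∀ σ : Finset (Fin 9),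
    (∀ i ∈ σ, ∀ j ∈ σ, i ≠ j → Hstar.Adj i j) →
    ∃ p q : Fin 9, Hstar.Adj p q ∧ ∀ r, r = p ∨ r = q →
      r ≠ 2 ∧ (r ∈ σ ∨ r < 7) ∧ ∀ k ∈ σ, k = r ∨ Hstar.Adj k r := by
  decide +kernel

theorem isNice_of_hstar_blowup [Fintype V] {Q : Fin 9 → Set V} (hpart : ∀ v, ∃! k, v ∈ Q k)
    (hP3 : ∀ k, ∀ a ∈ Q k, ∀ b ∈ Q k, ∀ c ∈ Q k, G.Adj a b → G.Adj b c → a ≠ c → G.Adj a c)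
    (hadj : ∀ k l, Hstar.Adj k l → ∀ a ∈ Q k, ∀ b ∈ Q l, G.Adj a b)
    (hnadj : ∀ k l, k ≠ l → ¬ Hstar.Adj k l → ∀ a ∈ Q k, ∀ b ∈ Q l, ¬ G.Adj a b)
    (hne : ∀ k < 7, (Q k).Nonempty) : IsNice G := by
  classical
  choose T hTQ hTs hTm using fun k => exists_maximal_stable G (Q k)
  have heq : ∀ {k l v}, v ∈ Q k → v ∈ Q l → k = l := fun {k l v} hk hl =>
    (hpart v).unique hk hl
  have hstable : ∀ I : Finset (Fin 9), (∀ k ∈ I, ∀ l ∈ I, ¬ Hstar.Adj k l) →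
      IsStableSet G {v | ∃ k ∈ I, v ∈ T k} := by
    rintro I hI a ⟨k, hk, ha⟩ b ⟨l, hl, hb⟩ hab
    by_cases hkl : k = l
    · subst hkl
      exact hTs k ha hb hab
    · exact hnadj k l hkl (hI k hk l hl) a (hTQ k ha) b (hTQ l hb)
  have hdisj : ∀ I J : Finset (Fin 9), (∀ k ∈ I, k ∉ J) →
      Disjoint {v | ∃ k ∈ I, v ∈ T k} {v | ∃ k ∈ J, v ∈ T k} := by
    intro I J hIJ
    refine Set.disjoint_left.2 ?_
    rintro v ⟨k, hk, hvk⟩ ⟨l, hl, hvl⟩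
    exact hIJ k hk (heq (hTQ k hvk) (hTQ l hvl) ▸ hl)
  refine ⟨{v | ∃ k ∈ ({1, 5} : Finset (Fin 9)), v ∈ T k},
    {v | ∃ k ∈ ({0, 4} : Finset (Fin 9)), v ∈ T k},
    {v | ∃ k ∈ ({3, 6, 7, 8} : Finset (Fin 9)), v ∈ T k},
    hstable _ (by decide +kernel), hstable _ (by decide +kernel), hstable _ (by decide +kernel),
    hdisj _ _ (by decide +kernel), hdisj _ _ (by decide +kernel), hdisj _ _ (by decide +kernel), ?_⟩
  generalize hU : ({v | ∃ k ∈ ({1, 5} : Finset (Fin 9)), v ∈ T k} ∪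
    {v | ∃ k ∈ ({0, 4} : Finset (Fin 9)), v ∈ T k} ∪
    {v | ∃ k ∈ ({3, 6, 7, 8} : Finset (Fin 9)), v ∈ T k}) = U
  have hTU : ∀ k, k ≠ 2 → ∀ v ∈ T k, v ∈ U := by
    have hk : ∀ k : Fin 9, k ≠ 2 → (k ∈ ({1, 5} : Finset (Fin 9)) ∨ k ∈ ({0, 4} : Finset (Fin 9))) ∨
      k ∈ ({3, 6, 7, 8} : Finset (Fin 9)) := by decide +kernel
    intro k hk2 v hv
    rw [← hU]
    exact (hk k hk2).imp (Or.imp (fun h => ⟨k, h, hv⟩) fun h => ⟨k, h, hv⟩) fun h => ⟨k, h, hv⟩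
  obtain ⟨s, hs⟩ := (G.induce Uᶜ).exists_isNClique_cliqueNum
  set K : Finset V := s.map (Function.Embedding.subtype _) with hK
  have hKU : ∀ v ∈ K, v ∉ U := by
    intro v hv
    obtain ⟨x, -, rfl⟩ := Finset.mem_map.1 hv
    exact x.2
  have hKc : ∀ a ∈ K, ∀ b ∈ K, a ≠ b → G.Adj a b := by
    intro a ha b hb hab
    obtain ⟨x, hx, rfl⟩ := Finset.mem_map.1 ha
    obtain ⟨y, hy, rfl⟩ := Finset.mem_map.1 hb
    exact hs.isClique hx hy fun h => hab (h ▸ rfl)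
  have hcard : K.card = (G.induce Uᶜ).cliqueNum := by rw [hK, Finset.card_map, hs.card_eq]
  obtain ⟨p, q, hpq, hr⟩ := hstar_clique_extension
    (Finset.univ.filter fun k => ∃ v ∈ K, v ∈ Q k) (by
      intro i hi j hj hij
      obtain ⟨a, ha, hai⟩ := (Finset.mem_filter.1 hi).2
      obtain ⟨b, hb, hbj⟩ := (Finset.mem_filter.1 hj).2
      by_contra hn
      exact hnadj i j hij hn a hai b hbj
        (hKc a ha b hb fun h => hij (heq hai (h ▸ hbj))))
  have hext : ∀ r, r = p ∨ r = q → ∃ t ∈ Q r, ∀ u ∈ K, G.Adj t u := by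
    intro r hrpq
    obtain ⟨hr2, hrσ, hrk⟩ := hr r hrpq
    have hother : ∀ t ∈ Q r, ∀ u ∈ K, u ∉ Q r → G.Adj t u := by
      intro t ht u hu hur
      obtain ⟨k, hk, -⟩ := hpart u
      rcases hrk k (Finset.mem_filter.2 ⟨Finset.mem_univ _, u, hu, hk⟩) with rfl | h
      · exact absurd hk hur
      · exact (hadj k r h u hk t ht).symm
    by_cases hv : ∃ v ∈ K, v ∈ Q r
    · obtain ⟨v, hvK, hvr⟩ := hv
      obtain ⟨t, ht, hvt⟩ := hTm r v hvr fun h => hKU v hvK (hTU r hr2 v h)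
      refine ⟨t, hTQ r ht, fun u hu => ?_⟩
      by_cases hur : u ∈ Q r
      · by_cases huv : v = u
        · exact huv ▸ hvt.symm
        · exact hP3 r t (hTQ r ht) v hvr u hur hvt.symm (hKc v hvK u hu huv)
            fun h => hKU u hu (hTU r hr2 u (h ▸ ht))
      · exact hother t (hTQ r ht) u hu hur
    · obtain ⟨t, ht⟩ := hne r (hrσ.resolve_left fun h => hv (Finset.mem_filter.1 h).2)
      exact ⟨t, ht, fun u hu => hother t ht u hu fun h => hv ⟨u, hu, h⟩⟩
  obtain ⟨a, hap, ha⟩ := hext p (.inl rfl)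
  obtain ⟨b, hbq, hb⟩ := hext q (.inr rfl)
  have hab := hadj p q hpq a hap b hbq
  have hbK : b ∉ K := fun h => G.irrefl (hb b h)
  have haK : a ∉ insert b K := by
    rw [Finset.mem_insert, not_or]
    exact ⟨hab.ne, fun h => G.irrefl (ha a h)⟩
  have hclique : G.IsClique (insert a (insert b K) : Finset V) := by
    rw [Finset.coe_insert, Finset.coe_insert]
    refine ((show G.IsClique (K : Set V) from fun x hx y hy => hKc x hx y hy).insert
      fun x hx _ => hb x hx).insert ?_
    rintro x (rfl | hx) -
    exacts [hab, ha x hx]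
  have := hclique.card_le_cliqueNum
  rw [Finset.card_insert_of_notMem haK, Finset.card_insert_of_notMem hbK, hcard] at this
  omega

end Nice

theorem exists_isAdjMatrixOf_coC7 {V : Type*} {G : SimpleGraph V}
    (h : Nonempty ((cycleGraph 7)ᶜ ↪g G)) : ∃ w, IsAdjMatrixOf G coC7 w := by
  obtain ⟨e⟩ := h
  have key : ∀ i j : Fin 7, (cycleGraph 7)ᶜ.Adj (5 * i) (5 * j) ↔ coC7 i j = true := by
    decide +kernel
  exact ⟨fun i => e (5 * i), fun i j => e.map_adj_iff.trans (key i j)⟩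

theorem stmt_5 {V : Type*} [Fintype V] (G : SimpleGraph V)
    (hconn : G.Connected)
    (hP5 : InducedFree (SimpleGraph.pathGraph 5) G)
    (hC5 : InducedFree (SimpleGraph.cycleGraph 5) G)
    (hW4 : InducedFree (wheel 4) G)
    (hC7c : Nonempty ((SimpleGraph.cycleGraph 7)ᶜ ↪g G)) :
    IsBlowup G Hstar ∧ IsNice G := by
  obtain ⟨w₀, hw₀⟩ := exists_isAdjMatrixOf_coC7 hC7c
  obtain ⟨r, hr⟩ := exists_rotate_inr_eq hP5 hC5 hW4 hw₀
  have hw := hw₀.rotate r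
  generalize (fun i => w₀ (i + r)) = w at hr hw
  let Q : Fin 9 → Set V := fun k => {v | AttachesLike G w (hstarType k) v}
  have hpart : ∀ v, ∃! k, v ∈ Q k := by
    intro v
    obtain ⟨l, hl⟩ := exists_attachesLike hP5 hC5 hW4 hw hconn v
    obtain ⟨k, rfl⟩ := exists_hstarType_eq l fun j hj => hr v j (hj ▸ hl)
    exact ⟨k, hl, fun k' hk' => hstarType_injective _ _ (AttachesLike.eq hk' hl)⟩
  have hP3 : ∀ k, ∀ a ∈ Q k, ∀ b ∈ Q k, ∀ c ∈ Q k,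
      G.Adj a b → G.Adj b c → a ≠ c → G.Adj a c :=
    fun k a ha b hb c hc => AttachesLike.adj_trans hW4 hw ha hb hc
  have hiff : ∀ k l, k ≠ l → ∀ a ∈ Q k, ∀ b ∈ Q l, (G.Adj a b ↔ Hstar.Adj k l) := by
    intro k l hkl a ha b hb
    rw [hstar_adj_iff]
    exact AttachesLike.adj_iff hP5 hC5 hW4 hw ha hb fun h => hkl (hstarType_injective _ _ h)
  have hadj : ∀ k l, Hstar.Adj k l → ∀ a ∈ Q k, ∀ b ∈ Q l, G.Adj a b :=
    fun k l h a ha b hb => (hiff k l h.ne a ha b hb).2 h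
  have hnadj : ∀ k l, k ≠ l → ¬ Hstar.Adj k l → ∀ a ∈ Q k, ∀ b ∈ Q l, ¬ G.Adj a b :=
    fun k l hkl h a ha b hb => mt (hiff k l hkl a ha b hb).1 h
  refine ⟨⟨Q, hpart, fun k => ?_, hadj, hnadj⟩, isNice_of_hstar_blowup hpart hP3 hadj hnadj ?_⟩
  · rw [inducedFree_pathGraph_three_iff]
    rintro ⟨a, ha⟩ ⟨b, hb⟩ ⟨c, hc⟩ hab hbc hac
    exact hP3 k a ha b hb c hc hab hbc fun h => hac (Subtype.ext h)
  · have htype : ∀ k < (7 : Fin 9), ∃ i : Fin 7, hstarType k = .inl i := by decide +kernel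
    intro k hk
    obtain ⟨i, hi⟩ := htype k hk
    exact ⟨w i, by simpa only [Q, Set.mem_ofPred_eq, hi] using attachesLike_self hw i⟩
end

section
/- Every (3K_1, 4-wheel)-free graph is either a quasi-line graph or a nice graph. -/
open SimpleGraph

section InducedFiveCycle

variable {V : Type*} {G : SimpleGraph V}

theorem InducedFree.not_three_nonadj (h : InducedFree (⊥ : SimpleGraph (Fin 3)) G) {x y z : V}
    (hxy : Gᶜ.Adj x y) (hyz : Gᶜ.Adj y z) (hxz : Gᶜ.Adj x z) : False := by
  rw [compl_adj] at hxy hyz hxz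
  refine h.false ⟨⟨![x, y, z], ?_⟩, ?_⟩
  · intro i j hij
    fin_cases i <;> fin_cases j <;> simp_all
  · intro i j
    change G.Adj (![x, y, z] i) (![x, y, z] j) ↔ _
    fin_cases i <;> fin_cases j <;> simp_all [G.adj_comm]

theorem InducedFree.not_four_wheel (h : InducedFree (wheel 4) G) {v p q r s : V}
    (hp : G.Adj v p) (hq : G.Adj v q) (hr : G.Adj v r) (hs : G.Adj v s)
    (hpq : G.Adj p q) (hqr : G.Adj q r) (hrs : G.Adj r s) (hsp : G.Adj s p)
    (hpr : Gᶜ.Adj p r) (hqs : Gᶜ.Adj q s) : False := by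
  rw [compl_adj] at hpr hqs
  have := hp.ne
  have := hq.ne
  have := hr.ne
  have := hs.ne
  have := hpq.ne
  have := hqr.ne
  have := hrs.ne
  have := hsp.ne
  refine h.false ⟨⟨Sum.elim ![p, q, r, s] fun _ => v, ?_⟩, ?_⟩
  · rintro (i | i) (j | j) hij
    · fin_cases i <;> fin_cases j <;> simp_all
    · fin_cases i <;> simp_all
    · fin_cases j <;> simp_all
    · rfl
  · rintro (i | i) (j | j)
    · have hadj : (wheel 4).Adj (.inl i) (.inl j) ↔ j = i + 1 ∨ i = j + 1 := by
        simp only [wheel, fromRel_adj, Sum.inl.injEq, cycleGraph_adj]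
        revert i j
        simp
        decide
      rw [hadj]
      change G.Adj (![p, q, r, s] i) (![p, q, r, s] j) ↔ _
      clear hadj
      fin_cases i <;> fin_cases j <;> simp_all [G.adj_comm]
    · change G.Adj (![p, q, r, s] i) v ↔ _
      fin_cases i <;> simp_all [wheel, G.adj_comm]
    · change G.Adj v (![p, q, r, s] j) ↔ _
      fin_cases j <;> simp_all [wheel, G.adj_comm]
    · simp [wheel]

/-- The vertices `c 0, …, c 4` form a chordless cycle in this order. -/
structure IsInducedFiveCycle (G : SimpleGraph V) (c : Fin 5 → V) : Prop where
  adj_succ : ∀ i, G.Adj (c i) (c (i + 1))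
  not_adj : ∀ i, ¬ G.Adj (c i) (c (i + 2))

/-- If the neighborhood of `v` is not the union of two cliques, it contains an induced `C₅`. -/
theorem exists_inducedFiveCycle_of_neighborSet (h3K1 : InducedFree (⊥ : SimpleGraph (Fin 3)) G)
    (hW4 : InducedFree (wheel 4) G) {v : V}
    (hv : ¬ ∃ K₁ K₂ : Set V, G.IsClique K₁ ∧ G.IsClique K₂ ∧ G.neighborSet v = K₁ ∪ K₂) :
    ∃ c, IsInducedFiveCycle G c ∧ ∀ i, G.Adj v (c i) := by
  by_contra! hc
  have five : ∀ {a p r q b : V}, G.Adj v a → G.Adj v p → G.Adj v r → G.Adj v q → G.Adj v b →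
      Gᶜ.Adj a p → Gᶜ.Adj p r → Gᶜ.Adj r q → Gᶜ.Adj q b → Gᶜ.Adj b a → False := by
    intro a p r q b ha hp hr hq hb hap hpr hrq hqb hba
    have tri : ∀ {x y z : V}, x ≠ z → Gᶜ.Adj x y → Gᶜ.Adj y z → G.Adj x z := by
      intro x y z hne hxy hyz
      by_contra hxz
      exact h3K1.not_three_nonadj hxy hyz ⟨hne, hxz⟩
    have nar : a ≠ r := by
      rintro rfl; exact h3K1.not_three_nonadj hrq hqb hba.symm
    have npq : p ≠ q := by
      rintro rfl; exact h3K1.not_three_nonadj hap hqb hba.symm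
    have nrb : r ≠ b := by
      rintro rfl; exact h3K1.not_three_nonadj hap hpr hba.symm
    have nqa : q ≠ a := by
      rintro rfl; exact h3K1.not_three_nonadj hap hpr hrq.symm
    have nbp : b ≠ p := by
      rintro rfl; exact h3K1.not_three_nonadj hpr hrq hqb.symm
    have har := tri nar hap hpr
    have hpq := tri npq hpr hrq
    have hrb := tri nrb hrq hqb
    have hqa := tri nqa hqb hba
    have hbp := tri nbp hba hap
    rw [compl_adj] at hap hpr hrq hqb hba
    obtain ⟨i, hi⟩ := hc ![a, r, b, p, q] ⟨by
      intro i; fin_cases i <;> simp_all, by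
      intro i; fin_cases i <;> simp_all [G.adj_comm]⟩
    fin_cases i <;> simp_all
  by_cases hcl : G.IsClique (G.neighborSet v)
  · exact hv ⟨_, _, hcl, hcl, (Set.union_self _).symm⟩
  obtain ⟨a, ha, b, hb, hne, hab⟩ : ∃ a, G.Adj v a ∧ ∃ b, G.Adj v b ∧ a ≠ b ∧ ¬ G.Adj a b := by
    simpa [IsClique, Set.Pairwise] using hcl
  have hab' : Gᶜ.Adj a b := ⟨hne, hab⟩
  have hout : ∀ {r s}, G.Adj v r → G.Adj v s → ¬ Gᶜ.Adj a r → ¬ Gᶜ.Adj b r → ¬ Gᶜ.Adj a s →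
      ¬ Gᶜ.Adj b s → r ≠ s → G.Adj r s := by
    intro r s hr hs har hbr has hbs hrs
    by_contra hn
    have hra : r ≠ a := by rintro rfl; exact hbr hab'.symm
    have hrb : r ≠ b := by rintro rfl; exact har hab'
    have hsa : s ≠ a := by rintro rfl; exact hbs hab'.symm
    have hsb : s ≠ b := by rintro rfl; exact has hab'
    simp only [compl_adj, not_and, not_not] at har hbr has hbs
    exact hW4.not_four_wheel ha hr hb hs (har hra.symm) (hbr hrb.symm).symm (hbs hsb.symm)
      (has hsa.symm).symm hab' ⟨hrs, hn⟩
  refine hv ⟨{x | G.Adj v x ∧ (Gᶜ.Adj a x ∨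
      (¬ Gᶜ.Adj b x ∧ ∀ p, G.Adj v p → Gᶜ.Adj a p → ¬ Gᶜ.Adj p x))},
    {x | G.Adj v x ∧ (Gᶜ.Adj b x ∨
      (¬ Gᶜ.Adj a x ∧ ∃ p, G.Adj v p ∧ Gᶜ.Adj a p ∧ Gᶜ.Adj p x))}, ?_, ?_, ?_⟩
  · rintro x ⟨hx, hx'⟩ y ⟨hy, hy'⟩ hxy
    by_contra hn
    have hxy' : Gᶜ.Adj x y := ⟨hxy, hn⟩
    by_cases hax : Gᶜ.Adj a x <;> by_cases hay : Gᶜ.Adj a y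
    · exact h3K1.not_three_nonadj hax hxy' hay
    · exact (hy'.resolve_left hay).2 x hx hax hxy'
    · exact (hx'.resolve_left hax).2 y hy hay hxy'.symm
    · exact hn (hout hx hy hax (hx'.resolve_left hax).1 hay (hy'.resolve_left hay).1 hxy)
  · rintro x ⟨hx, hx'⟩ y ⟨hy, hy'⟩ hxy
    by_contra hn
    have hxy' : Gᶜ.Adj x y := ⟨hxy, hn⟩
    by_cases hbx : Gᶜ.Adj b x <;> by_cases hby : Gᶜ.Adj b y
    · exact h3K1.not_three_nonadj hbx hxy' hby
    · obtain ⟨-, p, hp, hap, hpy⟩ := hy'.resolve_left hby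
      exact five ha hp hy hx hb hap hpy hxy'.symm hbx.symm hab'.symm
    · obtain ⟨-, p, hp, hap, hpx⟩ := hx'.resolve_left hbx
      exact five ha hp hx hy hb hap hpx hxy' hby.symm hab'.symm
    · exact hn (hout hx hy (hx'.resolve_left hbx).1 hbx (hy'.resolve_left hby).1 hby hxy)
  · ext x
    simp only [mem_neighborSet, Set.mem_union, Set.mem_ofPred_eq]
    constructor
    · intro hx
      by_cases hax : Gᶜ.Adj a x
      · exact .inl ⟨hx, .inl hax⟩
      by_cases hbx : Gᶜ.Adj b x
      · exact .inr ⟨hx, .inl hbx⟩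
      by_cases hp : ∃ p, G.Adj v p ∧ Gᶜ.Adj a p ∧ Gᶜ.Adj p x
      · exact .inr ⟨hx, .inr ⟨hax, hp⟩⟩
      · exact .inl ⟨hx, .inr ⟨hbx, fun p h1 h2 h3 => hp ⟨p, h1, h2, h3⟩⟩⟩
    · rintro (h | h) <;> exact h.1

namespace IsInducedFiveCycle

variable {c : Fin 5 → V}

theorem compl_adj (hc : IsInducedFiveCycle G c) (i : Fin 5) : Gᶜ.Adj (c i) (c (i + 2)) := by
  refine ⟨fun h => hc.not_adj (i + 3) ?_, hc.not_adj i⟩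
  have h1 : i + 3 + 2 = i := by clear * -; revert i; decide
  have h2 : i + 2 + 1 = i + 3 := by clear * -; revert i; decide
  have := hc.adj_succ (i + 2)
  rw [h1, h]
  rw [h2] at this
  exact this.symm

theorem adj_or_adj (hc : IsInducedFiveCycle G c) (h3K1 : InducedFree (⊥ : SimpleGraph (Fin 3)) G)
    {x : V} (hx : x ∉ Set.range c) (i : Fin 5) : G.Adj x (c i) ∨ G.Adj x (c (i + 2)) := by
  by_contra! h
  exact h3K1.not_three_nonadj (x := x) ⟨fun e => hx ⟨i, e.symm⟩, h.1⟩ (hc.compl_adj i)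
    ⟨fun e => hx ⟨_, e.symm⟩, h.2⟩

/-- A vertex complete to an induced `C₅` is adjacent to all other vertices. -/
theorem adj_of_forall_adj (hc : IsInducedFiveCycle G c)
    (h3K1 : InducedFree (⊥ : SimpleGraph (Fin 3)) G) (hW4 : InducedFree (wheel 4) G) {v x : V}
    (hv : ∀ i, G.Adj v (c i)) (hx : x ≠ v) : G.Adj v x := by
  classical
  by_contra hn
  have key : ∀ f : Fin 5 → Bool, (∀ i, f i = true ∨ f (i + 2) = true) →
      ∃ i, f i = true ∧ f (i + 1) = true ∧ f (i + 2) = true := by decide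
  obtain ⟨i, h0, h1, h2⟩ := key (fun i => decide (G.Adj x (c i))) (by
    simpa using hc.adj_or_adj h3K1 (by rintro ⟨i, rfl⟩; exact hn (hv i)))
  simp only [decide_eq_true_eq] at h0 h1 h2
  have h12 := hc.adj_succ (i + 1)
  rw [add_assoc, show (1 + 1 : Fin 5) = 2 from rfl] at h12
  exact hW4.not_four_wheel (hv (i + 1)).symm (hc.adj_succ i).symm h1.symm h12 (hv i) h0.symm h2
    (hv (i + 2)).symm ⟨hx.symm, hn⟩ (hc.compl_adj i)

/-- A vertex `x` of type `i` with respect to `c` has exactly the neighbors `c i`, `c (i + 1)`,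
`c (i + 4)` on it. -/
def HasType (G : SimpleGraph V) (c : Fin 5 → V) (x : V) (i : Fin 5) : Prop :=
  ∀ j, G.Adj x (c j) ↔ j = i ∨ j = i + 1 ∨ j = i + 4

theorem forall_adj_or_hasType (hc : IsInducedFiveCycle G c)
    (h3K1 : InducedFree (⊥ : SimpleGraph (Fin 3)) G) (hW4 : InducedFree (wheel 4) G) {v x : V}
    (hv : ∀ i, G.Adj v (c i)) (hx : x ∉ Set.range c) :
    (∀ i, G.Adj x (c i)) ∨ ∃ i, HasType G c x i := by
  classical
  by_cases hxv : x = v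
  · exact .inl (hxv ▸ hv)
  have hvx := hc.adj_of_forall_adj h3K1 hW4 hv hxv
  have key : ∀ f : Fin 5 → Bool, (∀ i, f i = true ∨ f (i + 2) = true) →
      (∀ i, f i = true → f (i + 2) = true → f (i + 1) = true) →
      (∀ i, f i = true) ∨ ∃ i, ∀ j, f j = true ↔ j = i ∨ j = i + 1 ∨ j = i + 4 := by decide
  have := key (fun i => decide (G.Adj x (c i))) (by simpa using hc.adj_or_adj h3K1 hx) (by
    simp only [decide_eq_true_eq]
    intro i h0 h2
    by_contra h1
    have h12 := hc.adj_succ (i + 1)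
    rw [add_assoc, show (1 + 1 : Fin 5) = 2 from rfl] at h12
    exact hW4.not_four_wheel hvx (hv i) (hv (i + 1)) (hv (i + 2)) h0 (hc.adj_succ i) h12 h2.symm
      ⟨fun e => hx ⟨_, e.symm⟩, h1⟩ (hc.compl_adj i))
  simpa [HasType] using this

theorem not_adj_of_hasType (hc : IsInducedFiveCycle G c)
    (h3K1 : InducedFree (⊥ : SimpleGraph (Fin 3)) G) (hW4 : InducedFree (wheel 4) G) {v x y : V}
    (hv : ∀ i, G.Adj v (c i)) (hx : x ∉ Set.range c) (hy : y ∉ Set.range c) {i : Fin 5}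
    (hxi : HasType G c x i) (hyi : HasType G c y (i + 2)) : ¬ G.Adj x y := by
  intro hxy
  have hv' : ∀ {z j}, HasType G c z j → G.Adj v z := by
    intro z j hz
    refine hc.adj_of_forall_adj h3K1 hW4 hv ?_
    rintro rfl
    have := (hz (j + 2)).1 (hv _)
    clear * - this
    revert this j
    decide
  have h1 : G.Adj y (c (i + 3)) := (hyi _).2 (by clear * -; revert i; decide)
  have h2 : G.Adj x (c (i + 4)) := (hxi _).2 (by simp)
  have h3 : ¬ G.Adj x (c (i + 3)) := by
    rw [hxi]; clear * -; revert i; decide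
  have h4 : ¬ G.Adj y (c (i + 4)) := by
    rw [hyi]; clear * -; revert i; decide
  have h5 := hc.adj_succ (i + 3)
  rw [show i + 3 + 1 = i + 4 by clear * -; revert i; decide] at h5
  exact hW4.not_four_wheel (hv' hxi) (hv' hyi) (hv _) (hv _) hxy h1 h5 h2.symm
    ⟨fun e => hx ⟨_, e.symm⟩, h3⟩ ⟨fun e => hy ⟨_, e.symm⟩, h4⟩

/-- Every clique avoiding `c` is complete to some edge of `c`. -/
theorem exists_forall_mem_adj (hc : IsInducedFiveCycle G c)
    (h3K1 : InducedFree (⊥ : SimpleGraph (Fin 3)) G) (hW4 : InducedFree (wheel 4) G) {v : V}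
    (hv : ∀ i, G.Adj v (c i)) {K : Set V} (hK : G.IsClique K) (hKc : ∀ x ∈ K, x ∉ Set.range c) :
    ∃ i, ∀ x ∈ K, G.Adj x (c i) ∧ G.Adj x (c (i + 1)) := by
  classical
  have key : ∀ T : Finset (Fin 5), (∀ i ∈ T, i + 2 ∉ T) →
      ∃ k, ∀ i ∈ T, i = k ∨ i = k + 1 := by decide
  obtain ⟨k, hk⟩ := key {i | ∃ x ∈ K, HasType G c x i} (by
    simp only [Finset.mem_filter, Finset.mem_univ, true_and]
    rintro i ⟨x, hx, hxi⟩ ⟨y, hy, hyi⟩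
    refine hc.not_adj_of_hasType h3K1 hW4 hv (hKc x hx) (hKc y hy) hxi hyi (hK hx hy ?_)
    rintro rfl
    have := (hxi (i + 3)).1 ((hyi _).2 (by clear * -; revert i; decide))
    clear * - this
    revert i
    decide)
  refine ⟨k, fun x hx => ?_⟩
  rcases hc.forall_adj_or_hasType h3K1 hW4 hv (hKc x hx) with h | ⟨i, hi⟩
  · exact ⟨h _, h _⟩
  · rw [hi, hi]
    have := hk i (by simpa using ⟨x, hx, hi⟩)
    clear * - this
    revert i k
    decide

theorem isNice [Finite V] (hc : IsInducedFiveCycle G c)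
    (h3K1 : InducedFree (⊥ : SimpleGraph (Fin 3)) G) (hW4 : InducedFree (wheel 4) G) {v : V}
    (hv : ∀ i, G.Adj v (c i)) : IsNice G := by
  classical
  have hinj : Function.Injective c := by
    intro i j hij
    by_contra hne
    have key : ∀ i j : Fin 5, i ≠ j → j = i + 1 ∨ i = j + 1 ∨ j = i + 2 ∨ i = j + 2 := by decide
    rcases key i j hne with rfl | rfl | rfl | rfl
    · exact (hc.adj_succ _).ne hij
    · exact (hc.adj_succ _).ne hij.symm
    · exact (hc.compl_adj _).ne hij
    · exact (hc.compl_adj _).ne hij.symm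
  have hstable : ∀ i, IsStableSet G {c i, c (i + 2)} := fun i =>
    Set.pairwise_pair.2 fun _ => ⟨hc.not_adj i, fun h => hc.not_adj i h.symm⟩
  refine ⟨{c 0, c 2}, {c 1, c 3}, {c 4}, hstable 0, hstable 1, Set.pairwise_singleton _ _,
    ?_, ?_, ?_, ?_⟩
  · simp [hinj.eq_iff]
  · simp [hinj.eq_iff]
  · simp [hinj.eq_iff]
  obtain ⟨K, hK, hcard⟩ := exists_isNClique_cliqueNum (G := G.induce
    (({c 0, c 2} ∪ {c 1, c 3} ∪ {c 4} : Set V)ᶜ))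
  rw [← hcard]
  have hKG : G.IsClique (K.map (Function.Embedding.subtype _) : Finset V) := by
    rintro x hx y hy hxy
    simp only [Finset.coe_map, Set.mem_image] at hx hy
    obtain ⟨x, hx, rfl⟩ := hx
    obtain ⟨y, hy, rfl⟩ := hy
    exact hK hx hy fun h => hxy (h ▸ rfl)
  have hKc : ∀ x ∈ (K.map (Function.Embedding.subtype _) : Finset V), x ∉ Set.range c := by
    rintro x hx ⟨i, rfl⟩
    obtain ⟨⟨y, hy⟩, -, rfl⟩ := Finset.mem_map.1 hx
    fin_cases i <;> simp_all
  obtain ⟨i, hi⟩ := hc.exists_forall_mem_adj h3K1 hW4 hv hKG hKc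
  set L := K.map (Function.Embedding.subtype _) with hL
  have hclique : G.IsClique (insert (c i) (insert (c (i + 1)) L) : Finset V) := by
    push_cast
    refine (hKG.insert fun x hx _ => (hi x hx).2.symm).insert ?_
    rintro x (rfl | hx) -
    · exact hc.adj_succ i
    · exact (hi x hx).1.symm
  have h1 : c (i + 1) ∉ L := fun h => hKc _ h ⟨_, rfl⟩
  have h0 : c i ∉ insert (c (i + 1)) L := by
    rw [Finset.mem_insert, not_or]
    exact ⟨(hc.adj_succ i).ne, fun h => hKc _ h ⟨_, rfl⟩⟩
  have := hclique.card_le_cliqueNum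
  rw [Finset.card_insert_of_notMem h0, Finset.card_insert_of_notMem h1, hL, Finset.card_map] at this
  omega

end IsInducedFiveCycle

end InducedFiveCycle

theorem stmt_6 {V : Type*} [Fintype V] (G : SimpleGraph V)
    (h3K1 : InducedFree (⊥ : SimpleGraph (Fin 3)) G)
    (hW4 : InducedFree (wheel 4) G) :
    IsQuasiLine G ∨ IsNice G := by
  rw [or_iff_not_imp_left]
  intro h
  obtain ⟨v, hv⟩ := not_forall.1 h
  obtain ⟨c, hc, hvc⟩ := exists_inducedFiveCycle_of_neighborSet h3K1 hW4 hv
  exact hc.isNice h3K1 hW4 hvc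
end
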